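/- arXiv:2601.04840 — 2 statements merged into one kernel-verified Lean document; each statement's English description precedes it below -/
import Mathlib

section
/- Let d ≥ 3 and x, y ∈ ℝ^d distinct. If the process (W^{x,y}(t))_{0 ≤ t ≤ τ_y} is distributed according to the excursion law μ^#_{x,y}, then its time reversal (W^{x,y}(τ_y − t))_{0 ≤ t ≤ τ_y} is distributed according to μ^#_{y,x}. -/
open MeasureTheory Real

/-- Borel σ-algebra on the space of continuous paths `C(ℝ, ℝ^d)` (compact-open topology). -/
noncomputable instance pathSpaceMeasurableSpace (d : ℕ) :
    MeasurableSpace C(ℝ, EuclideanSpace ℝ (Fin d)) := borel _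

/-- The heat kernel `p_t(x,y) = (2πt)^{-d/2} exp(-‖x-y‖²/(2t))` in `ℝ^d`. -/
noncomputable def heatKernel (d : ℕ) (t : ℝ) (x y : EuclideanSpace ℝ (Fin d)) : ℝ :=
  (2 * π * t) ^ (-(d:ℝ)/2) * Real.exp (-‖x - y‖ ^ 2 / (2 * t))

/-- The finite-dimensional density of the Brownian excursion measure `μ^#_{x,y}`:
for `0 = t₀ < t₁ < ⋯ < t_k < s = t_{k+1}` and points `z₁,…,z_k` (with `z₀ = x`,
`z_{k+1} = y`), the value `(2π^{d/2}/Γ(d/2−1)) ‖x−y‖^{d−2} ∏_{j=0}^k p_{t_{j+1}−t_j}(z_j, z_{j+1})`. -/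
noncomputable def excursionDensity (d : ℕ) (x y : EuclideanSpace ℝ (Fin d)) (k : ℕ)
    (t : Fin k → ℝ) (z : Fin k → EuclideanSpace ℝ (Fin d)) (s : ℝ) : ℝ :=
  let tt : Fin (k+2) → ℝ := Fin.snoc (Fin.cons 0 t) s
  let zz : Fin (k+2) → EuclideanSpace ℝ (Fin d) := Fin.snoc (Fin.cons x z) y
  (2 * π ^ ((d:ℝ)/2) / Real.Gamma ((d:ℝ)/2 - 1)) * ‖x - y‖ ^ ((d:ℝ) - 2) *
    ∏ j : Fin (k+1),
      heatKernel d (tt j.succ - tt j.castSucc) (zz j.castSucc) (zz j.succ)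

/-- `μ` is the law of the Brownian excursion from `x` to `y` in `ℝ^d`, viewed as a probability
measure on pairs (continuous path, duration): its finite-dimensional joint laws with the
duration have the densities of `μ^#_{x,y}`. -/
def IsExcursionLaw (d : ℕ) (x y : EuclideanSpace ℝ (Fin d))
    (μ : Measure (C(ℝ, EuclideanSpace ℝ (Fin d)) × ℝ)) : Prop :=
  IsProbabilityMeasure μ ∧
  ∀ (k : ℕ) (t : Fin k → ℝ), StrictMono t → (∀ j, 0 < t j) →
    (μ.map (fun p => ((fun j => p.1 (t j)), p.2))).restrict
        {q : (Fin k → EuclideanSpace ℝ (Fin d)) × ℝ | 0 < q.2 ∧ ∀ j, t j < q.2}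
      = (((Measure.pi fun _ : Fin k => (volume : Measure (EuclideanSpace ℝ (Fin d)))).prod
            (volume : Measure ℝ)).restrict
          {q | 0 < q.2 ∧ ∀ j, t j < q.2}).withDensity
          (fun q => ENNReal.ofReal (excursionDensity d x y k t q.1 q.2))

open MeasureTheory Real Filter Topology

/-- Euclidean space abbreviation. -/
abbrev ERev (d : ℕ) := EuclideanSpace ℝ (Fin d)

/-- Increments of the extended time vector. -/
noncomputable def incr (k : ℕ) (t : Fin k → ℝ) (s : ℝ) (j : Fin (k+1)) : ℝ :=
  (Fin.snoc (Fin.cons 0 t : Fin (k+1) → ℝ) s : Fin (k+2) → ℝ) j.succ -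
    (Fin.snoc (Fin.cons 0 t : Fin (k+1) → ℝ) s : Fin (k+2) → ℝ) j.castSucc

lemma incr_eq (k : ℕ) (t : Fin k → ℝ) (s : ℝ) (j : Fin (k+1)) :
    incr k t s j = (Fin.snoc t s : Fin (k+1) → ℝ) j - (Fin.cons 0 t : Fin (k+1) → ℝ) j := by
  unfold incr
  rw [← Fin.cons_snoc_eq_snoc_cons, Fin.cons_succ, Fin.cons_snoc_eq_snoc_cons]
  congr 1
  exact Fin.snoc_castSucc (α := fun _ => ℝ) _ _ _

lemma incr_pos (k : ℕ) (t : Fin k → ℝ) (s : ℝ) (ht : StrictMono t) (h0 : ∀ j, 0 < t j)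
    (hs : 0 < s) (hts : ∀ j, t j < s) (j : Fin (k+1)) : 0 < incr k t s j := by
  rw [incr_eq]
  have h1 : ∀ m : Fin (k+1), 0 < (Fin.snoc t s : Fin (k+1) → ℝ) m := by
    intro m
    refine Fin.lastCases ?_ (fun i => ?_) m <;> simp [hs, h0]
  have h2 : ∀ i : Fin k, ∀ m : Fin (k+1), i.castSucc < m →
      t i < (Fin.snoc t s : Fin (k+1) → ℝ) m := by
    intro i m
    refine Fin.lastCases ?_ (fun i => ?_) m
    · intro _; simp [hts]
    · intro h
      simpa using ht (by simpa using h)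
  refine Fin.cases ?_ (fun i => ?_) j
  · simpa using h1 0
  · have := h2 i i.succ Fin.castSucc_lt_succ
    simpa using this

lemma incr_mono (k : ℕ) (t : Fin k → ℝ) (a v s : ℝ) (hav : a ≤ v) (hvs : v ≤ s) (j : Fin (k+1)) :
    incr k (fun j => a - t j) a j ≤ incr k (fun j => v - t j) s j := by
  rw [incr_eq, incr_eq]
  refine Fin.cases ?_ (fun i => ?_) j
  · have : ∀ m : Fin (k+1), (Fin.snoc (fun j => a - t j) a : Fin (k+1) → ℝ) m ≤
      (Fin.snoc (fun j => v - t j) s : Fin (k+1) → ℝ) m := by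
      intro m
      refine Fin.lastCases ?_ (fun i => ?_) m
      · simp; linarith
      · simp; linarith
    simpa using this 0
  · have : ∀ m : Fin (k+1), (Fin.snoc (fun j => a - t j) a : Fin (k+1) → ℝ) m - a ≤
      (Fin.snoc (fun j => v - t j) s : Fin (k+1) → ℝ) m - v := by
      intro m
      refine Fin.lastCases ?_ (fun i => ?_) m
      · simp; linarith
      · simp
    have := this i.succ
    simp only [Fin.cons_succ]
    linarith

lemma heatKernel_symm (d : ℕ) (t : ℝ) (x y : ERev d) : heatKernel d t x y = heatKernel d t y x := by
  unfold heatKernel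
  rw [norm_sub_rev]

lemma heatKernel_bound (d : ℕ) (t δ : ℝ) (hδ : 0 < δ) (h : δ ≤ t) (x y : ERev d) :
    |heatKernel d t x y| ≤ (2 * π * δ) ^ (-(d:ℝ)/2) := by
  unfold heatKernel
  have ht : 0 < t := by linarith
  have hp := Real.pi_pos
  rw [abs_of_nonneg (by positivity)]
  have h1 : (2 * π * t) ^ (-(d:ℝ)/2) ≤ (2 * π * δ) ^ (-(d:ℝ)/2) := by
    apply Real.rpow_le_rpow_of_nonpos (by positivity) (by gcongr)
    have : (0:ℝ) ≤ d := by positivity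
    linarith
  have h2 : Real.exp (-‖x - y‖ ^ 2 / (2 * t)) ≤ 1 := by
    rw [Real.exp_le_one_iff]
    apply div_nonpos_of_nonpos_of_nonneg
    · simp; 
    · positivity
  calc _ ≤ (2 * π * δ) ^ (-(d:ℝ)/2) * 1 := by gcongr
    _ = _ := mul_one _

lemma excursionDensity_eq (d k : ℕ) (x y : ERev d) (t : Fin k → ℝ) (z : Fin k → ERev d) (s : ℝ) :
    excursionDensity d x y k t z s =
    (2 * π ^ ((d:ℝ)/2) / Real.Gamma ((d:ℝ)/2 - 1)) * ‖x - y‖ ^ ((d:ℝ) - 2) *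
    ∏ j : Fin (k+1), heatKernel d (incr k t s j)
      ((Fin.snoc (Fin.cons x z : Fin (k+1) → ERev d) y : Fin (k+2) → ERev d) j.castSucc)
      ((Fin.snoc (Fin.cons x z : Fin (k+1) → ERev d) y : Fin (k+2) → ERev d) j.succ) := rfl

lemma excursionDensity_bound (d k : ℕ) (x y : ERev d) (δ : ℝ) (hδ : 0 < δ) :
    ∃ B, ∀ (t : Fin k → ℝ) (z : Fin k → ERev d) (s : ℝ), (∀ j, δ ≤ incr k t s j) →
      |excursionDensity d x y k t z s| ≤ B := by
  refine ⟨|(2 * π ^ ((d:ℝ)/2) / Real.Gamma ((d:ℝ)/2 - 1)) * ‖x - y‖ ^ ((d:ℝ) - 2)| *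
    ∏ j : Fin (k+1), (2 * π * δ) ^ (-(d:ℝ)/2), fun t z s h => ?_⟩
  rw [excursionDensity_eq, abs_mul, Finset.abs_prod]
  gcongr with j hj
  exact heatKernel_bound d _ δ hδ (h j) _ _

lemma excursionDensity_rev (d k : ℕ) (x y : ERev d) (t : Fin k → ℝ) (z : Fin k → ERev d) (s : ℝ) :
    excursionDensity d x y k (fun j => s - t j.rev) (fun j => z j.rev) s =
      excursionDensity d y x k t z s := by
  rw [excursionDensity_eq, excursionDensity_eq, norm_sub_rev]
  congr 1
  rw [← Equiv.prod_comp Fin.revPerm]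
  have hz : (Fin.snoc (Fin.cons x (fun j => z j.rev) : Fin (k+1) → ERev d) y : Fin (k+2) → ERev d)
      = (Fin.snoc (Fin.cons y z : Fin (k+1) → ERev d) x : Fin (k+2) → ERev d) ∘ Fin.rev := by
    rw [Fin.snoc_comp_rev, Fin.cons_comp_rev, Fin.cons_snoc_eq_snoc_cons]
    rfl
  have ht : (Fin.snoc (Fin.cons 0 (fun j => s - t j.rev) : Fin (k+1) → ℝ) s : Fin (k+2) → ℝ)
      = fun j => s - ((Fin.snoc (Fin.cons 0 t : Fin (k+1) → ℝ) s : Fin (k+2) → ℝ) ∘ Fin.rev) j := by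
    rw [Fin.snoc_comp_rev, Fin.cons_comp_rev, ← Fin.cons_snoc_eq_snoc_cons]
    funext j
    refine Fin.cases ?_ (fun i => ?_) j
    · simp
    · simp only [Fin.cons_succ]
      refine Fin.lastCases ?_ (fun i => ?_) i
      · simp
      · simp
  refine Finset.prod_congr rfl fun j _ => ?_
  rw [heatKernel_symm, hz]
  unfold incr
  rw [ht]
  simp only [Fin.revPerm_apply, Function.comp, Fin.rev_castSucc, Fin.rev_succ, Fin.rev_rev]
  congr 1
  ring

lemma incr_continuous (k : ℕ) (j : Fin (k+1)) :
    Continuous fun q : (Fin k → ℝ) × ℝ => incr k q.1 q.2 j := by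
  have h : Continuous fun q : (Fin k → ℝ) × ℝ =>
      (Fin.snoc (Fin.cons 0 q.1 : Fin (k+1) → ℝ) q.2 : Fin (k+2) → ℝ) :=
    Continuous.finSnoc (A := fun _ => ℝ)
      (Continuous.finCons (A := fun _ => ℝ) continuous_const continuous_fst) continuous_snd
  unfold incr
  exact ((continuous_apply j.succ).comp h).sub ((continuous_apply j.castSucc).comp h)

lemma excursionDensity_measurable (d k : ℕ) (x y : ERev d) :
    Measurable fun q : (Fin k → ℝ) × (Fin k → ERev d) × ℝ =>
      excursionDensity d x y k q.1 q.2.1 q.2.2 := by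
  simp only [excursionDensity_eq]
  refine Measurable.const_mul (Finset.measurable_prod _ fun j _ => ?_) _
  have h : Continuous fun q : (Fin k → ℝ) × (Fin k → ERev d) × ℝ =>
      (Fin.snoc (Fin.cons x q.2.1 : Fin (k+1) → ERev d) y : Fin (k+2) → ERev d) :=
    Continuous.finSnoc (A := fun _ => ERev d)
      (Continuous.finCons (A := fun _ => ERev d) continuous_const
        (continuous_fst.comp continuous_snd)) continuous_const
  have h1 := ((continuous_apply j.castSucc).comp h).measurable
  have h2 := ((continuous_apply j.succ).comp h).measurable
  have h3 : Measurable fun q : (Fin k → ℝ) × (Fin k → ERev d) × ℝ => incr k q.1 q.2.2 j :=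
    (incr_continuous k j).measurable.comp
      (measurable_fst.prodMk (measurable_snd.comp measurable_snd))
  simp only [Function.comp_def] at h1 h2
  unfold heatKernel
  exact ((h3.const_mul _).pow_const _).mul
    (Real.measurable_exp.comp ((((h1.sub h2).norm.pow_const 2).neg).div (h3.const_mul 2)))

lemma excursionDensity_tendsto (d k : ℕ) (x y : ERev d) (t : Fin k → ℝ) (z : Fin k → ERev d) (s : ℝ)
    (hpos : ∀ j, 0 < incr k t s j) (u : ℕ → Fin k → ℝ) (hu : Tendsto u atTop (𝓝 t)) :
    Tendsto (fun n => excursionDensity d x y k (u n) z s) atTop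
      (𝓝 (excursionDensity d x y k t z s)) := by
  simp only [excursionDensity_eq]
  refine Tendsto.const_mul _ (tendsto_finsetProd _ fun j _ => ?_)
  have h : Tendsto (fun n => incr k (u n) s j) atTop (𝓝 (incr k t s j)) :=
    ((incr_continuous k j).tendsto (t, s)).comp (hu.prodMk_nhds tendsto_const_nhds)
  have hp := Real.pi_pos
  have := hpos j
  unfold heatKernel
  refine Tendsto.mul ((h.const_mul _).rpow_const (Or.inl (by positivity))) ?_
  refine (Real.continuous_exp.tendsto _).comp ?_
  exact tendsto_const_nhds.div (h.const_mul 2) (by positivity)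

lemma exists_max (k : ℕ) (t : Fin k → ℝ) (ht : StrictMono t) (h0 : ∀ j, 0 < t j) :
    ∃ T : ℝ, 0 ≤ T ∧ (∀ j, t j ≤ T) ∧ ∀ s, (0 < s ∧ ∀ j, t j < s) ↔ T < s := by
  cases k with
  | zero => exact ⟨0, le_rfl, fun j => j.elim0, fun s => ⟨fun h => h.1, fun h => ⟨h, fun j => j.elim0⟩⟩⟩
  | succ k =>
    have hm : ∀ j, t j ≤ t (Fin.last k) := fun j => ht.monotone (Fin.le_last j)
    exact ⟨t (Fin.last k), (h0 _).le, hm, fun s => ⟨fun h => h.2 _, fun h =>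
      ⟨(h0 _).trans h, fun j => (hm j).trans_lt h⟩⟩⟩

/-- Reversal of the order of the points. -/
def revMap (d k : ℕ) (q : (Fin k → ERev d) × ℝ) : (Fin k → ERev d) × ℝ :=
  (fun j => q.1 j.rev, q.2)

/-- Reference measure. -/
noncomputable abbrev refM (d k : ℕ) : Measure ((Fin k → ERev d) × ℝ) :=
  (Measure.pi fun _ : Fin k => (volume : Measure (EuclideanSpace ℝ (Fin d)))).prod
            (volume : Measure ℝ)

lemma revMap_measurable (d k : ℕ) : Measurable (revMap d k) := by
  unfold revMap
  exact (measurable_pi_lambda _ fun j => (measurable_pi_apply _).comp measurable_fst).prodMk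
    measurable_snd

lemma revMap_invol (d k : ℕ) (q) : revMap d k (revMap d k q) = q := by
  simp [revMap]

lemma revMap_mp (d k : ℕ) : MeasurePreserving (revMap d k) (refM d k) (refM d k) := by
  have h := measurePreserving_arrowCongr' (fun _ : Fin k => (volume : Measure (ERev d)))
    (fun _ : Fin k => (volume : Measure (ERev d))) Fin.revPerm (MeasurableEquiv.refl _)
    (fun i => MeasurePreserving.id _)
  exact h.prod (MeasurePreserving.id (volume : Measure ℝ))

lemma map_withDensity_rev (d k : ℕ) (g : (Fin k → ERev d) × ℝ → ENNReal) (hg : Measurable g) :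
    ((refM d k).withDensity g).map (revMap d k) = (refM d k).withDensity (g ∘ revMap d k) := by
  ext A hA
  rw [Measure.map_apply (revMap_measurable d k) hA,
    withDensity_apply _ (revMap_measurable d k hA), withDensity_apply _ hA]
  rw [← (revMap_mp d k).setLIntegral_comp_preimage hA (hg.comp (revMap_measurable d k))]
  simp [revMap_invol]

/-- grid approximation from below -/
noncomputable def grid (a : ℝ) (n : ℕ) (s : ℝ) : ℝ := a + (⌊(s - a) * (n+1)⌋₊ : ℝ) / (n+1)

lemma grid_measurable (a : ℝ) (n : ℕ) : Measurable (grid a n) := by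
  unfold grid
  have : Measurable fun s : ℝ => ⌊(s - a) * (n+1)⌋₊ :=
    Nat.measurable_floor.comp ((measurable_id.sub_const a).mul_const _)
  exact ((measurable_from_top.comp this).div_const _).const_add _

lemma grid_ge (a : ℝ) (n : ℕ) (s : ℝ) : a ≤ grid a n s := by
  unfold grid
  have : (0:ℝ) ≤ (⌊(s - a) * (n+1)⌋₊ : ℝ) / (n+1) := by positivity
  linarith

lemma grid_le (a : ℝ) (n : ℕ) (s : ℝ) (h : a ≤ s) : grid a n s ≤ s := by
  unfold grid
  have h1 := Nat.floor_le (a := (s - a) * ((n:ℝ)+1)) (by have := sub_nonneg.2 h; positivity)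
  have : (⌊(s - a) * (n+1)⌋₊ : ℝ) / (n+1) ≤ s - a := by
    rw [div_le_iff₀ (by positivity)]; exact h1
  linarith

lemma grid_tendsto (a s : ℝ) (h : a ≤ s) : Tendsto (fun n => grid a n s) atTop (𝓝 s) := by
  have h2 : Tendsto (fun n : ℕ => s - 1 / ((n:ℝ) + 1)) atTop (𝓝 (s - 0)) :=
    tendsto_const_nhds.sub tendsto_one_div_add_atTop_nhds_zero_nat
  rw [sub_zero] at h2
  refine tendsto_of_tendsto_of_tendsto_of_le_of_le h2 tendsto_const_nhds ?_
    (fun n => grid_le a n s h)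
  intro n
  simp only [grid]
  have h1 := Nat.lt_floor_add_one ((s - a) * ((n:ℝ)+1))
  have : s - a ≤ (⌊(s - a) * (n+1)⌋₊ : ℝ) / (n+1) + 1 / (n+1) := by
    rw [← add_div, le_div_iff₀ (by positivity)]; exact h1.le
  linarith

instance pathBorel (d : ℕ) : BorelSpace C(ℝ, EuclideanSpace ℝ (Fin d)) := ⟨rfl⟩

/-- Evaluate the path backwards from time `r τ`. -/
def backEval (d k : ℕ) (t : Fin k → ℝ) (r : ℝ → ℝ) (p : C(ℝ, EuclideanSpace ℝ (Fin d)) × ℝ) :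
    (Fin k → ERev d) × ℝ := (fun j => p.1 (r p.2 - t j), p.2)

lemma backEval_measurable (d k : ℕ) (t : Fin k → ℝ) (r : ℝ → ℝ) (hr : Measurable r) :
    Measurable (backEval d k t r) := by
  unfold backEval
  refine (measurable_pi_lambda _ fun j => ?_).prodMk measurable_snd
  have he : Continuous fun q : C(ℝ, EuclideanSpace ℝ (Fin d)) × ℝ => q.1 q.2 := by fun_prop
  exact he.measurable.comp
    (measurable_fst.prodMk ((hr.comp measurable_snd).sub_const _))

/-- density at level of approximation `r` -/
noncomputable def apxDensity (d k : ℕ) (x y : ERev d) (t : Fin k → ℝ) (r : ℝ → ℝ)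
    (q : (Fin k → ERev d) × ℝ) : ℝ :=
  excursionDensity d x y k (fun j => r q.2 - t j.rev) (fun j => q.1 j.rev) q.2

lemma apxDensity_measurable (d k : ℕ) (x y : ERev d) (t : Fin k → ℝ) (r : ℝ → ℝ)
    (hr : Measurable r) : Measurable (apxDensity d k x y t r) := by
  unfold apxDensity
  have hg : Measurable fun q : (Fin k → ERev d) × ℝ =>
      (((fun j => r q.2 - t j.rev), ((fun j => q.1 j.rev), q.2)) :
        (Fin k → ℝ) × (Fin k → ERev d) × ℝ) := by
    refine Measurable.prodMk ?_ (revMap_measurable d k)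
    exact measurable_pi_lambda _ fun j => (hr.comp measurable_snd).sub_const _
  have hH := (excursionDensity_measurable d k x y).comp hg
  simp only [Function.comp_def] at hH
  exact hH

lemma piece (d k : ℕ) (x y : ERev d) (μ : Measure (C(ℝ, EuclideanSpace ℝ (Fin d)) × ℝ))
    (hμ : IsExcursionLaw d x y μ) (t : Fin k → ℝ) (ht : StrictMono t) (h0 : ∀ j, 0 < t j)
    (v : ℝ) (hv : 0 < v) (htv : ∀ j, t j < v) (S : Set ((Fin k → ERev d) × ℝ))
    (B : Set ℝ) (hB : MeasurableSet B) (hS : S = Prod.snd ⁻¹' B) (hBv : ∀ s ∈ B, v ≤ s) :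
    (μ.map (backEval d k t fun _ => v)).restrict S =
      ((refM d k).withDensity
        (fun q => ENNReal.ofReal (apxDensity d k x y t (fun _ => v) q))).restrict S := by
  have hSm : MeasurableSet S := hS ▸ measurable_snd hB
  have H := hμ.2 k (fun j => v - t j.rev) (fun i j hij => by
    have := ht (Fin.rev_lt_rev.2 hij)
    simp only; linarith) (fun j => by have := htv j.rev; linarith)
  set U : Set ((Fin k → ERev d) × ℝ) := {q | 0 < q.2 ∧ ∀ j : Fin k, v - t j.rev < q.2} with hU
  have hUm : MeasurableSet U := by
    rw [hU, Set.ofPred_and, Set.ofPred_forall]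
    refine MeasurableSet.inter (measurableSet_lt measurable_const measurable_snd) ?_
    exact MeasurableSet.iInter fun j => measurableSet_lt measurable_const measurable_snd
  have hSU : S ⊆ U := by
    intro q hq
    rw [hS] at hq
    have := hBv _ hq
    exact ⟨by linarith, fun j => by have := h0 j.rev; linarith⟩
  rw [← restrict_withDensity hUm] at H
  have H2 := congrArg (fun m => Measure.restrict m S) H
  simp only [Measure.restrict_restrict hSm, Set.inter_eq_left.2 hSU] at H2
  have hψ : Measurable (fun p : C(ℝ, EuclideanSpace ℝ (Fin d)) × ℝ =>
      ((fun j : Fin k => p.1 (v - t j.rev)), p.2)) :=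
    backEval_measurable d k (fun j => t j.rev) (fun _ => v) measurable_const
  have h1 : backEval d k t (fun _ => v) = revMap d k ∘ (fun p : C(ℝ, EuclideanSpace ℝ (Fin d)) × ℝ =>
      ((fun j : Fin k => p.1 (v - t j.rev)), p.2)) := by
    funext p
    simp [backEval, revMap]
  have hpre : revMap d k ⁻¹' S = S := by
    rw [hS]; rfl
  have hdm : Measurable fun q : (Fin k → ERev d) × ℝ =>
      ENNReal.ofReal (excursionDensity d x y k (fun j => v - t j.rev) q.1 q.2) := by
    have hg : Measurable fun q : (Fin k → ERev d) × ℝ =>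
        (((fun j => v - t j.rev), (q.1, q.2)) : (Fin k → ℝ) × (Fin k → ERev d) × ℝ) :=
      measurable_const.prodMk (measurable_fst.prodMk measurable_snd)
    have hH := (excursionDensity_measurable d k x y).comp hg
    simp only [Function.comp_def] at hH
    exact hH.ennreal_ofReal
  rw [h1, ← Measure.map_map (revMap_measurable d k) hψ,
    Measure.restrict_map (revMap_measurable d k) hSm, hpre, H2]
  nth_rewrite 1 [← hpre]
  rw [← Measure.restrict_map (revMap_measurable d k) hSm, map_withDensity_rev d k _ hdm]
  rfl

lemma approx (d k : ℕ) (x y : ERev d) (μ : Measure (C(ℝ, EuclideanSpace ℝ (Fin d)) × ℝ))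
    (hμ : IsExcursionLaw d x y μ) (t : Fin k → ℝ) (ht : StrictMono t) (h0 : ∀ j, 0 < t j)
    (a : ℝ) (ha : 0 < a) (hta : ∀ j, t j < a) (n : ℕ) :
    (μ.map (backEval d k t (grid a n))).restrict {q | a ≤ q.2} =
      ((refM d k).withDensity
        (fun q => ENNReal.ofReal (apxDensity d k x y t (grid a n) q))).restrict {q | a ≤ q.2} := by
  have hUn : {q : (Fin k → ERev d) × ℝ | a ≤ q.2} =
      ⋃ m : ℕ, Prod.snd ⁻¹' {s : ℝ | a ≤ s ∧ ⌊(s - a) * (n+1)⌋₊ = m} := by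
    ext q; simp
  rw [hUn, Measure.restrict_iUnion_congr]
  intro m
  set v : ℝ := a + (m:ℝ) / (n+1) with hv
  have hav : a ≤ v := by
    have : (0:ℝ) ≤ (m:ℝ) / (n+1) := by positivity
    linarith
  have hfl : Measurable fun s : ℝ => ⌊(s - a) * (n+1)⌋₊ :=
    Nat.measurable_floor.comp ((measurable_id.sub_const a).mul_const _)
  have hBm : MeasurableSet {s : ℝ | a ≤ s ∧ ⌊(s - a) * (n+1)⌋₊ = m} :=
    (measurableSet_le measurable_const measurable_id).inter (hfl (measurableSet_singleton m))
  have hgr : ∀ s ∈ {s : ℝ | a ≤ s ∧ ⌊(s - a) * (n+1)⌋₊ = m}, grid a n s = v := by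
    intro s hs
    simp only [grid, hs.2, hv]
  have P := piece d k x y μ hμ t ht h0 v (by linarith) (fun j => by have := hta j; linarith)
    _ _ hBm rfl (fun s hs => by rw [← hgr s hs]; exact grid_le a n s hs.1)
  have hSm : MeasurableSet (Prod.snd ⁻¹' {s : ℝ | a ≤ s ∧ ⌊(s - a) * (n+1)⌋₊ = m} :
      Set ((Fin k → ERev d) × ℝ)) := measurable_snd hBm
  have hL : (μ.map (backEval d k t (grid a n))).restrict
        (Prod.snd ⁻¹' {s : ℝ | a ≤ s ∧ ⌊(s - a) * (n+1)⌋₊ = m}) =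
      (μ.map (backEval d k t fun _ => v)).restrict
        (Prod.snd ⁻¹' {s : ℝ | a ≤ s ∧ ⌊(s - a) * (n+1)⌋₊ = m}) := by
    rw [Measure.restrict_map (backEval_measurable d k t _ (grid_measurable a n)) hSm,
      Measure.restrict_map (backEval_measurable d k t _ measurable_const) hSm]
    have e1 : backEval d k t (grid a n) ⁻¹'
        (Prod.snd ⁻¹' {s : ℝ | a ≤ s ∧ ⌊(s - a) * (n+1)⌋₊ = m}) =
        backEval d k t (fun _ => v) ⁻¹'
        (Prod.snd ⁻¹' {s : ℝ | a ≤ s ∧ ⌊(s - a) * (n+1)⌋₊ = m}) := rfl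
    rw [e1]
    apply Measure.map_congr
    filter_upwards [ae_restrict_mem
      (backEval_measurable d k t (fun _ => v) measurable_const hSm)] with p hp
    simp only [backEval, hgr p.2 hp]
  rw [hL, P, restrict_withDensity hSm, restrict_withDensity hSm]
  apply withDensity_congr_ae
  filter_upwards [ae_restrict_mem hSm] with q hq
  simp only [apxDensity, hgr q.2 hq]

lemma main_a (d k : ℕ) (x y : ERev d) (μ : Measure (C(ℝ, EuclideanSpace ℝ (Fin d)) × ℝ))
    (hμ : IsExcursionLaw d x y μ) (t : Fin k → ℝ) (ht : StrictMono t) (h0 : ∀ j, 0 < t j)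
    (a : ℝ) (ha : 0 < a) (hta : ∀ j, t j < a) :
    (μ.map (backEval d k t id)).restrict {q | a ≤ q.2} =
      ((refM d k).withDensity
        (fun q => ENNReal.ofReal (apxDensity d k x y t id q))).restrict {q | a ≤ q.2} := by
  have hprob := hμ.1
  set V : Set ((Fin k → ERev d) × ℝ) := {q | a ≤ q.2} with hV
  have hVm : MeasurableSet V := measurableSet_le measurable_const measurable_snd
  -- uniform bound
  obtain ⟨δ, hδ, hδ'⟩ : ∃ δ > 0, ∀ j, δ ≤ incr k (fun j => a - t j.rev) a j := by
    have hpos := incr_pos k (fun j => a - t j.rev) a (fun i j hij => by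
      have := ht (Fin.rev_lt_rev.2 hij)
      simp only; linarith) (fun j => by have := hta j.rev; linarith) ha
      (fun j => by have := h0 j.rev; linarith)
    obtain ⟨j0, hj0⟩ := Finite.exists_min (fun j => incr k (fun j => a - t j.rev) a j)
    exact ⟨_, hpos j0, hj0⟩
  obtain ⟨B, hB⟩ := excursionDensity_bound d k x y δ hδ
  have hinc : ∀ v s, a ≤ v → v ≤ s → ∀ j, δ ≤ incr k (fun j => v - t j.rev) s j :=
    fun v s h1 h2 j => (hδ' j).trans (incr_mono k (fun j => t j.rev) a v s h1 h2 j)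
  have hBn : ∀ n, ∀ q ∈ V, |apxDensity d k x y t (grid a n) q| ≤ B := fun n q hq =>
    hB _ _ _ (hinc _ _ (grid_ge a n q.2) (grid_le a n q.2 hq))
  have hBi : ∀ q ∈ V, |apxDensity d k x y t id q| ≤ B := fun q hq =>
    hB _ _ _ (hinc _ _ hq le_rfl)
  have hlim : ∀ q ∈ V, Tendsto (fun n => apxDensity d k x y t (grid a n) q) atTop
      (𝓝 (apxDensity d k x y t id q)) := by
    intro q hq
    refine excursionDensity_tendsto d k x y _ _ _
      (fun j => hδ.trans_le (hinc q.2 q.2 hq le_rfl j)) _ ?_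
    rw [tendsto_pi_nhds]
    intro j
    exact (grid_tendsto a q.2 hq).sub_const _
  have hfin : IsFiniteMeasureOnCompacts (((refM d k).withDensity
        (fun q => ENNReal.ofReal (apxDensity d k x y t id q))).restrict V) := by
    refine ⟨fun K hK => ?_⟩
    rw [Measure.restrict_apply hK.measurableSet,
      withDensity_apply _ (hK.measurableSet.inter hVm)]
    calc _ ≤ ∫⁻ q in K ∩ V, ENNReal.ofReal B ∂(refM d k) := by
            refine setLIntegral_mono' (hK.measurableSet.inter hVm) fun q hq => ?_
            exact ENNReal.ofReal_le_ofReal ((le_abs_self _).trans (hBi q hq.2))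
      _ = ENNReal.ofReal B * refM d k (K ∩ V) := by
            rw [setLIntegral_const]
      _ < ⊤ := ENNReal.mul_lt_top ENNReal.ofReal_lt_top
            ((measure_mono Set.inter_subset_left).trans_lt hK.measure_lt_top)
  have hprob2 : IsProbabilityMeasure (μ.map (backEval d k t id)) :=
    Measure.isProbabilityMeasure_map (backEval_measurable d k t id measurable_id).aemeasurable
  refine Measure.ext_of_integral_eq_on_compactlySupported fun f => ?_
  obtain ⟨M, hM⟩ : ∃ M, ∀ q, ‖f q‖ ≤ M :=
    f.hasCompactSupport.exists_bound_of_continuous f.continuous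
  have hfc : Continuous f := f.continuous
  have hfi : Integrable f (refM d k) := hfc.integrable_of_hasCompactSupport f.hasCompactSupport
  have Lint : ∀ r : ℝ → ℝ, Measurable r →
      ∫ q, f q ∂((μ.map (backEval d k t r)).restrict V) =
        ∫ p in Prod.snd ⁻¹' Set.Ici a, f (backEval d k t r p) ∂μ := by
    intro r hr
    rw [setIntegral_map hVm hfc.aestronglyMeasurable (backEval_measurable d k t r hr).aemeasurable]
    rfl
  have Rint : ∀ r : ℝ → ℝ, Measurable r →
      ∫ q, f q ∂(((refM d k).withDensity
        (fun q => ENNReal.ofReal (apxDensity d k x y t r q))).restrict V) =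
        ∫ q in V, max (apxDensity d k x y t r q) 0 * f q ∂(refM d k) := by
    intro r hr
    rw [setIntegral_withDensity_eq_setIntegral_toReal_smul
      (apxDensity_measurable d k x y t r hr).ennreal_ofReal
      (ae_of_all _ fun _ => ENNReal.ofReal_lt_top) _ hVm]
    simp only [ENNReal.toReal_ofReal', smul_eq_mul]
  have hL : Tendsto (fun n => ∫ p in Prod.snd ⁻¹' Set.Ici a, f (backEval d k t (grid a n) p) ∂μ)
      atTop (𝓝 (∫ p in Prod.snd ⁻¹' Set.Ici a, f (backEval d k t id p) ∂μ)) := by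
    refine tendsto_integral_of_dominated_convergence (fun _ => M) ?_ (integrable_const _) ?_ ?_
    · exact fun n => (hfc.measurable.comp
        (backEval_measurable d k t _ (grid_measurable a n))).aestronglyMeasurable
    · exact fun n => ae_of_all _ fun p => hM _
    · filter_upwards [ae_restrict_mem (measurable_snd measurableSet_Ici)] with p hp
      refine (hfc.tendsto _).comp ?_
      refine Tendsto.prodMk_nhds ?_ tendsto_const_nhds
      rw [tendsto_pi_nhds]
      intro j
      exact (p.1.continuous.tendsto _).comp ((grid_tendsto a p.2 hp).sub_const _)
  have hR : Tendsto (fun n => ∫ q in V, max (apxDensity d k x y t (grid a n) q) 0 * f q ∂(refM d k))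
      atTop (𝓝 (∫ q in V, max (apxDensity d k x y t id q) 0 * f q ∂(refM d k))) := by
    refine tendsto_integral_of_dominated_convergence (fun q => B * ‖f q‖) ?_
      (hfi.norm.const_mul B).integrableOn ?_ ?_
    · exact fun n => (((apxDensity_measurable d k x y t _ (grid_measurable a n)).max
        measurable_const).mul hfc.measurable).aestronglyMeasurable
    · intro n
      filter_upwards [ae_restrict_mem hVm] with q hq
      rw [norm_mul]
      gcongr
      have := hBn n q hq
      rw [Real.norm_eq_abs, abs_of_nonneg (le_max_right _ _)]
      exact max_le ((le_abs_self _).trans this) ((abs_nonneg _).trans this)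
    · filter_upwards [ae_restrict_mem hVm] with q hq
      exact ((hlim q hq).max tendsto_const_nhds).mul_const _
  rw [Lint id measurable_id, Rint id measurable_id]
  refine tendsto_nhds_unique hL (hR.congr fun n => ?_)
  rw [← Lint _ (grid_measurable a n), ← Rint _ (grid_measurable a n),
    approx d k x y μ hμ t ht h0 a ha hta n]

/-- **Time reversal of the Brownian excursion.** If `(W^{x,y}(t))_{0≤t≤τ}` is distributed
according to the excursion law `μ^#_{x,y}` (`d ≥ 3`, `x ≠ y`), then the time reversal
`(W^{x,y}(τ − t))_{0≤t≤τ}` is distributed according to `μ^#_{y,x}`. -/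
theorem excursion_time_reversal (d : ℕ) (hd : 3 ≤ d)
    (x y : EuclideanSpace ℝ (Fin d)) (hxy : x ≠ y)
    (μ : Measure (C(ℝ, EuclideanSpace ℝ (Fin d)) × ℝ)) (hμ : IsExcursionLaw d x y μ) :
    IsExcursionLaw d y x
      (μ.map (fun p =>
        (p.1.comp ⟨fun t => p.2 - t, by continuity⟩, p.2))) := by
  have hprob := hμ.1
  have hc : Continuous (fun p : C(ℝ, EuclideanSpace ℝ (Fin d)) × ℝ =>
        ((p.1.comp ⟨fun t => p.2 - t, by continuity⟩, p.2) :
          C(ℝ, EuclideanSpace ℝ (Fin d)) × ℝ)) := by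
    refine Continuous.prodMk ?_ continuous_snd
    refine ContinuousMap.continuous_of_continuous_uncurry _ ?_
    simp only [Function.uncurry_def, ContinuousMap.comp_apply, ContinuousMap.coe_mk]
    fun_prop
  refine ⟨Measure.isProbabilityMeasure_map hc.measurable.aemeasurable, fun k t ht h0 => ?_⟩
  have he : Measurable (fun p : C(ℝ, EuclideanSpace ℝ (Fin d)) × ℝ =>
      ((fun j : Fin k => p.1 (t j)), p.2)) := by
    refine (measurable_pi_lambda _ fun j => ?_).prodMk measurable_snd
    have : Continuous fun q : C(ℝ, EuclideanSpace ℝ (Fin d)) × ℝ => q.1 (t j) := by fun_prop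
    exact this.measurable
  rw [Measure.map_map he hc.measurable]
  obtain ⟨T, hT0, hTj, hT⟩ := exists_max k t ht h0
  have hUm : MeasurableSet {q : (Fin k → EuclideanSpace ℝ (Fin d)) × ℝ | 0 < q.2 ∧ ∀ j, t j < q.2} := by
    simp only [hT]
    exact measurableSet_lt measurable_const measurable_snd
  rw [← restrict_withDensity hUm]
  have hUn : {q : (Fin k → EuclideanSpace ℝ (Fin d)) × ℝ | 0 < q.2 ∧ ∀ j, t j < q.2} =
      ⋃ n : ℕ, {q | T + 1 / ((n:ℝ) + 1) ≤ q.2} := by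
    ext q
    simp only [hT, Set.mem_ofPred_eq, Set.mem_iUnion]
    constructor
    · intro h
      obtain ⟨n, hn⟩ := exists_nat_one_div_lt (sub_pos.2 h)
      exact ⟨n, by linarith⟩
    · rintro ⟨n, hn⟩
      have : (0:ℝ) < 1 / ((n:ℝ) + 1) := by positivity
      linarith
  rw [hUn, Measure.restrict_iUnion_congr]
  intro n
  have hpos : (0:ℝ) < 1 / ((n:ℝ) + 1) := by positivity
  have H := main_a d k x y μ hμ t ht h0 (T + 1 / ((n:ℝ) + 1)) (by linarith)
    (fun j => by have := hTj j; linarith)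
  have hd : apxDensity d k x y t id = fun q => excursionDensity d y x k t q.1 q.2 := by
    funext q
    exact excursionDensity_rev d k x y t q.1 q.2
  rw [hd] at H
  exact H
end

section
/- In d = 3, for all r ∈ (0,1), the Brownian loop measure of the set of loops that intersect both the unit sphere S² and the sphere rS² is at most ((1+r)/2)·((1−r)^{−2} − 1). -/
open MeasureTheory Real

/-- `Q` is the law `P^{x,x;T}` of the Brownian bridge of duration `T` from `x` to `x` in
`ℝ^d`, viewed as a probability measure on continuous paths which sit at `x` outside `(0, T)`:
its finite-dimensional distributions at times `0 < t₁ < ⋯ < t_k < T` have density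
`(2πT)^{d/2} ∏_{j=0}^k p_{t_{j+1}−t_j}(z_j, z_{j+1})` (with `t₀ = 0`, `t_{k+1} = T`,
`z₀ = z_{k+1} = x`) with respect to Lebesgue measure. -/
def IsBrownianBridge (d : ℕ) (x : EuclideanSpace ℝ (Fin d)) (T : ℝ)
    (Q : Measure C(ℝ, EuclideanSpace ℝ (Fin d))) : Prop :=
  IsProbabilityMeasure Q ∧
  (∀ᵐ w ∂Q, w 0 = x ∧ ∀ s : ℝ, s ∉ Set.Ioo 0 T → w s = x) ∧
  ∀ (k : ℕ) (t : Fin k → ℝ), StrictMono t → (∀ j, t j ∈ Set.Ioo 0 T) →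
    Q.map (fun w => fun j => w (t j))
      = (Measure.pi fun _ : Fin k => (volume : Measure (EuclideanSpace ℝ (Fin d)))).withDensity
          (fun z =>
            let tt : Fin (k+2) → ℝ := Fin.snoc (Fin.cons 0 t) T
            let zz : Fin (k+2) → EuclideanSpace ℝ (Fin d) := Fin.snoc (Fin.cons x z) x
            ENNReal.ofReal ((2 * π * T) ^ ((d:ℝ)/2) *
              ∏ j : Fin (k+1), heatKernel d (tt j.succ - tt j.castSucc) (zz j.castSucc) (zz j.succ)))

/-- `μ` is the Brownian loop measure in `ℝ³`:
`μ^loop = ∫_{ℝ³} dx ∫₀^∞ (dt/t) (2πt)^{−3/2} P^{x,x;t}`, where `Q x t = P^{x,x;t}` is the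
Brownian bridge of duration `t` from `x` to `x`. -/
def IsBrownianLoopMeasure (μ : Measure C(ℝ, EuclideanSpace ℝ (Fin 3))) : Prop :=
  ∃ Q : EuclideanSpace ℝ (Fin 3) → ℝ → Measure C(ℝ, EuclideanSpace ℝ (Fin 3)),
    (∀ x t, 0 < t → IsBrownianBridge 3 x t (Q x t)) ∧
    ∀ A : Set C(ℝ, EuclideanSpace ℝ (Fin 3)), MeasurableSet A →
      μ A = ∫⁻ x, ∫⁻ t in Set.Ioi (0:ℝ),
        ENNReal.ofReal (t⁻¹ * (2 * π * t) ^ (-(3:ℝ)/2)) * Q x t A ∂volume ∂volume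

open MeasureTheory Real
open scoped ENNReal

namespace LoopCross

abbrev E3 := EuclideanSpace ℝ (Fin 3)

/-- heat kernel with values in `ℝ≥0∞` -/
noncomputable def pE (s : ℝ) (x y : E3) : ℝ≥0∞ := ENNReal.ofReal (heatKernel 3 s x y)

/-- radial profile of the heat kernel -/
noncomputable def pd (s δ : ℝ) : ℝ := (2 * π * s) ^ (-(3:ℝ)/2) * Real.exp (-δ ^ 2 / (2 * s))

lemma heatKernel_eq_pd (s : ℝ) (x y : E3) : heatKernel 3 s x y = pd s ‖x - y‖ := by
  simp [heatKernel, pd]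

lemma pd_nonneg {s : ℝ} (hs : 0 ≤ s) (δ : ℝ) : 0 ≤ pd s δ := by
  unfold pd; positivity

lemma pd_anti {s : ℝ} (hs : 0 < s) {δ δ' : ℝ} (h0 : 0 ≤ δ) (h : δ ≤ δ') : pd s δ' ≤ pd s δ := by
  unfold pd
  gcongr

lemma measurable_pd : Measurable (fun q : ℝ × ℝ => pd q.1 q.2) := by
  unfold pd; fun_prop

lemma measurable_pE : Measurable (fun q : ℝ × E3 × E3 => pE q.1 q.2.1 q.2.2) := by
  unfold pE heatKernel; fun_prop

lemma Measurable.pE' {α : Type*} [MeasurableSpace α] {a : α → ℝ} {b c : α → E3}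
    (ha : Measurable a) (hb : Measurable b) (hc : Measurable c) :
    Measurable (fun q => pE (a q) (b q) (c q)) :=
  measurable_pE.comp (ha.prodMk (hb.prodMk hc))

lemma pE_symm (s : ℝ) (x y : E3) : pE s x y = pE s y x := by
  simp [pE, heatKernel_eq_pd, norm_sub_rev]

lemma lintegral_ofReal_of_integral {α : Type*} [MeasurableSpace α] {μ : Measure α} {f : α → ℝ}
    {c : ℝ} (hf : ∀ᵐ x ∂μ, 0 ≤ f x) (hc : 0 < c) (h : ∫ x, f x ∂μ = c) :
    ∫⁻ x, ENNReal.ofReal (f x) ∂μ = ENNReal.ofReal c := by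
  rw [← h, ofReal_integral_eq_lintegral_ofReal _ hf]
  by_contra hi
  rw [integral_undef hi] at h
  linarith

lemma integral_pd {s : ℝ} (hs : 0 < s) : ∫ y : E3, pd s ‖y‖ = 1 := by
  unfold pd
  rw [integral_const_mul]
  have := GaussianFourier.integral_rexp_neg_mul_sq_norm (V := E3) (b := 1 / (2 * s)) (by positivity)
  have h2 : ∀ v : E3, -‖v‖ ^ 2 / (2 * s) = -(1 / (2 * s)) * ‖v‖ ^ 2 := by intro v; ring
  simp_rw [h2]
  rw [this]
  have : π / (1 / (2 * s)) = 2 * π * s := by field_simp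
  rw [this, ← Real.rpow_add (by positivity)]
  norm_num

lemma lintegral_pd_sub {s : ℝ} (hs : 0 < s) (x : E3) :
    ∫⁻ y : E3, ENNReal.ofReal (pd s ‖y - x‖) = 1 := by
  rw [lintegral_sub_right_eq_self (fun y : E3 => ENNReal.ofReal (pd s ‖y‖)) x]
  rw [lintegral_ofReal_of_integral (c := 1) (Filter.Eventually.of_forall
    fun y => pd_nonneg hs.le _) one_pos (integral_pd hs)]
  simp

lemma lintegral_pE {s : ℝ} (hs : 0 < s) (x : E3) : ∫⁻ y, pE s x y = 1 := by
  simp_rw [pE_symm s x, pE, heatKernel_eq_pd]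
  exact lintegral_pd_sub hs x

lemma pE_mul {s t : ℝ} (hs : 0 < s) (ht : 0 < t) (x y z : E3) :
    pE s x z * pE t z y = pE (s + t) x y *
      ENNReal.ofReal (pd (s * t / (s + t)) ‖z - ((t / (s + t)) • x + (s / (s + t)) • y)‖) := by
  simp only [pE, heatKernel_eq_pd]
  rw [← ENNReal.ofReal_mul (pd_nonneg hs.le _), ← ENNReal.ofReal_mul (pd_nonneg (by positivity) _)]
  congr 1
  unfold pd
  have e1 : (2 * π * s) ^ (-(3:ℝ)/2) * (2 * π * t) ^ (-(3:ℝ)/2)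
      = (2 * π * (s + t)) ^ (-(3:ℝ)/2) * (2 * π * (s * t / (s + t))) ^ (-(3:ℝ)/2) := by
    rw [← Real.mul_rpow (by positivity) (by positivity),
      ← Real.mul_rpow (by positivity) (by positivity)]
    congr 1
    field_simp
  have e2 : -‖x - z‖ ^ 2 / (2 * s) + -‖z - y‖ ^ 2 / (2 * t)
      = -‖x - y‖ ^ 2 / (2 * (s + t)) +
        -‖z - ((t / (s + t)) • x + (s / (s + t)) • y)‖ ^ 2 / (2 * (s * t / (s + t))) := by
    simp only [EuclideanSpace.norm_sq_eq, Fin.sum_univ_three, Real.norm_eq_abs, sq_abs,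
      PiLp.sub_apply, PiLp.add_apply, PiLp.smul_apply, smul_eq_mul]
    field_simp
    ring
  calc _ = ((2 * π * s) ^ (-(3:ℝ)/2) * (2 * π * t) ^ (-(3:ℝ)/2)) *
        Real.exp (-‖x - z‖ ^ 2 / (2 * s) + -‖z - y‖ ^ 2 / (2 * t)) := by
          rw [Real.exp_add]; ring
    _ = _ := by rw [e1, e2, Real.exp_add]; ring

lemma lintegral_pE_mul {s t : ℝ} (hs : 0 < s) (ht : 0 < t) (x y : E3) :
    ∫⁻ z, pE s x z * pE t z y = pE (s + t) x y := by
  simp_rw [pE_mul hs ht x y]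
  rw [lintegral_const_mul, lintegral_pd_sub (by positivity), mul_one]
  have := measurable_pd
  exact (this.comp (measurable_const.prodMk (by fun_prop))).ennreal_ofReal

lemma integral_sq_pd {s : ℝ} (hs : 0 < s) : ∫ y : E3, ‖y‖ ^ 2 * pd s ‖y‖ = 3 * s := by
  rw [integral_fun_norm_addHaar volume (fun ρ => ρ ^ 2 * pd s ρ)]
  simp only [finrank_euclideanSpace, Fintype.card_fin, smul_eq_mul, nsmul_eq_mul, Measure.real,
    EuclideanSpace.volume_ball_fin_three]
  have : ∀ y ∈ Set.Ioi (0:ℝ), y ^ (3 - 1) * (y ^ 2 * pd s y)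
      = (2 * π * s) ^ (-(3:ℝ)/2) * (y ^ (4:ℝ) * Real.exp (-(1 / (2 * s)) * y ^ (2:ℝ))) := by
    intro y hy
    unfold pd
    rw [show (4:ℝ) = ((4:ℕ):ℝ) by norm_num, show (2:ℝ) = ((2:ℕ):ℝ) by norm_num,
      Real.rpow_natCast, Real.rpow_natCast]
    push_cast
    rw [show -y ^ 2 / (2 * s) = -(1 / (2 * s)) * y ^ 2 by ring]
    ring
  rw [setIntegral_congr_fun measurableSet_Ioi this, integral_const_mul,
    integral_rpow_mul_exp_neg_mul_rpow (by norm_num) (by norm_num) (by positivity)]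
  have hG : Real.Gamma ((4 + 1) / 2) = 3 / 4 * √π := by
    rw [show ((4:ℝ) + 1) / 2 = (1/2 + 1) + 1 by norm_num, Real.Gamma_add_one (by norm_num),
      Real.Gamma_add_one (by norm_num), Real.Gamma_one_half_eq]
    ring
  rw [hG]
  have h1 : (2 * π * s) ^ (-(3:ℝ)/2) = π ^ (-(3:ℝ)/2) * (2 * s) ^ (-(3:ℝ)/2) := by
    rw [← Real.mul_rpow (by positivity) (by positivity)]; congr 1; ring
  have h2 : (1 / (2 * s)) ^ (-(4 + 1) / 2 : ℝ) = (2 * s) ^ ((5:ℝ)/2) := by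
    rw [one_div, Real.inv_rpow (by positivity), ← Real.rpow_neg (by positivity)]; norm_num
  have h3 : π ^ (-(3:ℝ)/2) * √π * π = 1 := by
    rw [Real.sqrt_eq_rpow, ← Real.rpow_add pi_pos]
    nth_rewrite 2 [← Real.rpow_one π]
    rw [← Real.rpow_add pi_pos]; norm_num
  have h4 : (2 * s) ^ (-(3:ℝ)/2) * (2 * s) ^ ((5:ℝ)/2) = 2 * s := by
    rw [← Real.rpow_add (by positivity)]; norm_num
  rw [h1, h2]
  have h5 : (ENNReal.ofReal 1 ^ 3 * ENNReal.ofReal (π * 4 / 3)).toReal = π * 4 / 3 := by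
    simp; positivity
  rw [h5]
  push_cast
  calc _ = (π ^ (-(3:ℝ)/2) * √π * π) * ((2 * s) ^ (-(3:ℝ)/2) * (2 * s) ^ ((5:ℝ)/2)) * (3/2) := by
        ring
    _ = _ := by rw [h3, h4]; ring

/-- The quadratic moment in a direction of fixed norm does not depend on the direction. -/
lemma lintegral_inner_sq_congr (s : ℝ) {g g' : E3} (h : ‖g‖ = ‖g'‖) :
    ∫⁻ z : E3, ENNReal.ofReal (pd s ‖z‖ * (inner ℝ g z) ^ 2)
      = ∫⁻ z : E3, ENNReal.ofReal (pd s ‖z‖ * (inner ℝ g' z) ^ 2) := by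
  set L := (ℝ ∙ (g - g'))ᗮ.reflection
  have hL : L g = g' := Submodule.reflection_sub h
  have := (LinearIsometryEquiv.measurePreserving L).lintegral_comp_emb
    L.toHomeomorph.measurableEmbedding
    (fun z : E3 => ENNReal.ofReal (pd s ‖z‖ * (inner ℝ g' z) ^ 2))
  rw [← this]
  simp only [← hL, LinearIsometryEquiv.norm_map, LinearIsometryEquiv.inner_map_map]

lemma lintegral_inner_sq {s : ℝ} (hs : 0 < s) (g : E3) :
    ∫⁻ z : E3, ENNReal.ofReal (pd s ‖z‖ * (inner ℝ g z) ^ 2) = ENNReal.ofReal (s * ‖g‖ ^ 2) := by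
  have hm : ∀ g : E3, Measurable fun z : E3 => ENNReal.ofReal (pd s ‖z‖ * (inner ℝ g z) ^ 2) := by
    intro g
    refine Measurable.ennreal_ofReal (Measurable.mul ?_ (by fun_prop))
    exact measurable_pd.comp (measurable_const.prodMk (by fun_prop))
  have key : ∀ i : Fin 3, ∫⁻ z : E3, ENNReal.ofReal (pd s ‖z‖ *
      (inner ℝ (‖g‖ • EuclideanSpace.single i (1:ℝ)) z) ^ 2)
      = ∫⁻ z : E3, ENNReal.ofReal (pd s ‖z‖ * (inner ℝ g z) ^ 2) := by
    intro i
    apply lintegral_inner_sq_congr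
    simp [norm_smul]
  have sum : ∑ i : Fin 3, ∫⁻ z : E3, ENNReal.ofReal (pd s ‖z‖ *
      (inner ℝ (‖g‖ • EuclideanSpace.single i (1:ℝ)) z) ^ 2)
      = ENNReal.ofReal (‖g‖ ^ 2) * ENNReal.ofReal (3 * s) := by
    rw [← lintegral_finsetSum _ (fun i _ => hm _)]
    rw [← lintegral_ofReal_of_integral (Filter.Eventually.of_forall fun y : E3 =>
      mul_nonneg (sq_nonneg ‖y‖) (pd_nonneg hs.le _)) (by positivity) (integral_sq_pd hs)]
    rw [← lintegral_const_mul']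
    · congr 1
      ext z
      rw [← ENNReal.ofReal_sum_of_nonneg, ← ENNReal.ofReal_mul (by positivity)]
      · congr 1
        rw [EuclideanSpace.norm_sq_eq z]
        simp [Fin.sum_univ_three, inner_smul_left, EuclideanSpace.inner_single_left]
        ring
      · intro i _
        exact mul_nonneg (pd_nonneg hs.le _) (sq_nonneg _)
    · simp
  simp only [key, Finset.sum_const, Finset.card_univ, Fintype.card_fin, nsmul_eq_mul] at sum
  have h3 : ENNReal.ofReal (‖g‖ ^ 2) * ENNReal.ofReal (3 * s)
     = (3:ℕ) * ENNReal.ofReal (s * ‖g‖ ^ 2) := by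
    rw [← ENNReal.ofReal_mul (by positivity), ← ENNReal.ofReal_natCast, ← ENNReal.ofReal_mul (by positivity)]
    congr 1; push_cast; ring
  rw [h3] at sum
  exact (ENNReal.mul_right_inj (by simp) (by simp)).1 sum

lemma lintegral_pd_time {δ : ℝ} (hδ : 0 < δ) :
    ∫⁻ t in Set.Ioi (0:ℝ), ENNReal.ofReal (pd t δ) = ENNReal.ofReal (1 / (2 * π * δ)) := by
  have himg : (fun v : ℝ => (v ^ 2)⁻¹) '' Set.Ioi 0 = Set.Ioi 0 := by
    ext t
    simp only [Set.mem_image, Set.mem_Ioi]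
    constructor
    · rintro ⟨v, hv, rfl⟩; positivity
    · intro ht
      refine ⟨(√t)⁻¹, by positivity, ?_⟩
      rw [inv_pow, Real.sq_sqrt ht.le, inv_inv]
  rw [← himg]
  rw [lintegral_image_eq_lintegral_abs_deriv_mul measurableSet_Ioi
    (f' := fun v => -(2 * v) / (v ^ 2) ^ 2)]
  · have hcongr : ∀ v ∈ Set.Ioi (0:ℝ), ENNReal.ofReal |(-(2 * v) / (v ^ 2) ^ 2)| *
        ENNReal.ofReal (pd ((v ^ 2)⁻¹) δ)
        = ENNReal.ofReal ((2 * (2 * π) ^ (-(3:ℝ)/2)) * Real.exp (-(δ ^ 2 / 2) * v ^ 2)) := by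
      intro v hv
      have hv : 0 < v := hv
      rw [← ENNReal.ofReal_mul (abs_nonneg _)]
      congr 1
      unfold pd
      rw [abs_div, abs_neg, abs_of_pos (by positivity : 0 < 2 * v),
        abs_of_pos (by positivity : 0 < (v ^ 2) ^ 2), Real.mul_rpow (by positivity) (by positivity)]
      have : ((v ^ 2)⁻¹) ^ (-(3:ℝ)/2) = v ^ 3 := by
        rw [Real.inv_rpow (by positivity), ← Real.rpow_neg (by positivity), ← Real.rpow_natCast,
          ← Real.rpow_mul hv.le, ← Real.rpow_natCast]
        norm_num
      rw [this]
      have h2 : -δ ^ 2 / (2 * (v ^ 2)⁻¹) = -(δ ^ 2 / 2) * v ^ 2 := by field_simp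
      rw [h2]
      field_simp
    rw [setLIntegral_congr_fun measurableSet_Ioi hcongr]
    have hval : (2 * (2 * π) ^ (-(3:ℝ)/2)) * (√(π / (δ ^ 2 / 2)) / 2) = 1 / (2 * π * δ) := by
      have : √(π / (δ ^ 2 / 2)) = (2 * π) ^ ((1:ℝ)/2) / δ := by
        rw [← Real.sqrt_eq_rpow, show π / (δ ^ 2 / 2) = (2 * π) / δ ^ 2 by field_simp,
          Real.sqrt_div (by positivity), Real.sqrt_sq hδ.le]
      rw [this]
      have : (2 * π) ^ (-(3:ℝ)/2) * (2 * π) ^ ((1:ℝ)/2) = (2 * π)⁻¹ := by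
        rw [← Real.rpow_add (by positivity), ← Real.rpow_neg_one]; norm_num
      calc _ = ((2 * π) ^ (-(3:ℝ)/2) * (2 * π) ^ ((1:ℝ)/2)) / δ := by ring
        _ = _ := by rw [this]; field_simp
    rw [← hval]
    apply lintegral_ofReal_of_integral
    · exact Filter.Eventually.of_forall fun v => by positivity
    · positivity
    · rw [integral_const_mul, integral_gaussian_Ioi]
  · intro v hv
    have hv : v ≠ 0 := (ne_of_gt hv)
    have := ((hasDerivAt_pow 2 v).fun_inv (pow_ne_zero 2 hv)).hasDerivWithinAt (s := Set.Ioi 0)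
    simpa using this
  · intro a ha b hb h
    simp only [inv_inj] at h
    exact (pow_left_inj₀ (le_of_lt ha) (le_of_lt hb) two_ne_zero).1 h

lemma lintegral_comp_mul_Ioi (f : ℝ → ℝ≥0∞) {c : ℝ} (hc : 0 < c) :
    ENNReal.ofReal c * ∫⁻ t in Set.Ioi (0:ℝ), f (c * t) = ∫⁻ t in Set.Ioi (0:ℝ), f t := by
  have himg : (fun v : ℝ => c * v) '' Set.Ioi 0 = Set.Ioi 0 := by
    ext t
    simp only [Set.mem_image, Set.mem_Ioi]
    constructor
    · rintro ⟨v, hv, rfl⟩; positivity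
    · intro ht
      exact ⟨t / c, by positivity, by field_simp⟩
  conv_rhs => rw [← himg]
  rw [lintegral_image_eq_lintegral_abs_deriv_mul measurableSet_Ioi (f' := fun v => c)]
  · rw [lintegral_const_mul' _ _ (by simp), abs_of_pos hc]
  · intro v hv
    simpa using ((hasDerivAt_id v).const_mul c).hasDerivWithinAt (s := Set.Ioi 0)
  · intro a ha b hb h
    exact mul_left_cancel₀ hc.ne' h

end LoopCross

open MeasureTheory Real
open scoped ENNReal

namespace LoopCross

/-- radial test function: `1` on the ball of radius `r`, `0` outside the ball of radius `R` -/
noncomputable def vf (r R : ℝ) (x : E3) : ℝ :=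
  ((min (max ‖x‖ r) R)⁻¹ - R⁻¹) / (r⁻¹ - R⁻¹)

/-- its gradient -/
noncomputable def gf (r R : ℝ) (x : E3) : E3 :=
  if r < ‖x‖ ∧ ‖x‖ < R then (-(r⁻¹ - R⁻¹)⁻¹ / ‖x‖ ^ 3) • x else 0

lemma finite_norm_eq (x z : E3) (hz : z ≠ 0) (ρ : ℝ) : {τ : ℝ | ‖x + τ • z‖ = ρ}.Finite := by
  classical
  set p : Polynomial ℝ := Polynomial.C (‖z‖ ^ 2) * Polynomial.X ^ 2 +
    Polynomial.C (2 * inner ℝ x z) * Polynomial.X + Polynomial.C (‖x‖ ^ 2 - ρ ^ 2) with hp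
  have hp0 : p ≠ 0 := by
    intro h
    have := congrArg Polynomial.natDegree h
    rw [hp, Polynomial.natDegree_quadratic (by positivity)] at this
    simp at this
  refine (p.roots.toFinset.finite_toSet).subset ?_
  intro τ hτ
  simp only [Set.mem_ofPred_eq] at hτ
  simp only [Finset.mem_coe, Multiset.mem_toFinset, Polynomial.mem_roots hp0, Polynomial.IsRoot]
  have := @norm_add_sq_real E3 _ _ x (τ • z)
  rw [hτ, inner_smul_right, norm_smul, mul_pow, Real.norm_eq_abs, sq_abs] at this
  simp [hp]
  linarith

lemma continuous_vf {r R : ℝ} (hr : 0 < r) (hR : r < R) : Continuous (vf r R) := by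
  unfold vf
  refine (Continuous.sub (Continuous.inv₀ (by fun_prop) ?_) continuous_const).div_const _
  intro x
  have : 0 < min (max ‖x‖ r) R := lt_min (lt_max_of_lt_right hr) (hr.trans hR)
  exact this.ne'

lemma vf_of_le {r R : ℝ} (hr : 0 < r) (hR : r < R) {x : E3} (hx : ‖x‖ ≤ r) : vf r R x = 1 := by
  unfold vf
  rw [max_eq_right hx, min_eq_left hR.le, div_self]
  have := (inv_lt_inv₀ (hr.trans hR) hr).2 hR
  linarith

lemma vf_of_ge {r R : ℝ} (hR : r < R) {x : E3} (hx : R ≤ ‖x‖) : vf r R x = 0 := by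
  unfold vf
  rw [min_eq_right (le_max_of_le_left hx)]
  simp

lemma vf_mem {r R : ℝ} (hr : 0 < r) (hR : r < R) (x : E3) : 0 ≤ vf r R x ∧ vf r R x ≤ 1 := by
  have h := (inv_lt_inv₀ (hr.trans hR) hr).2 hR
  have h1 : r ≤ min (max ‖x‖ r) R := le_min (le_max_right _ _) hR.le
  have h2 : min (max ‖x‖ r) R ≤ R := min_le_right _ _
  have h3 := inv_anti₀ hr h1
  have h4 := inv_anti₀ (hr.trans_le h1) h2
  unfold vf
  constructor
  · apply div_nonneg <;> linarith
  · rw [div_le_one] <;> linarith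

lemma measurable_gf (r R : ℝ) : Measurable (gf r R) := by
  unfold gf
  refine Measurable.ite ?_ (by fun_prop) measurable_const
  exact (measurableSet_lt measurable_const measurable_norm).inter
    (measurableSet_lt measurable_norm measurable_const)

lemma norm_gf_sq {r R : ℝ} (hr : 0 < r) (x : E3) : ‖gf r R x‖ ^ 2 =
    (Set.Ioo r R).indicator (fun ρ => ((r⁻¹ - R⁻¹)⁻¹) ^ 2 / ρ ^ 4) ‖x‖ := by
  unfold gf
  by_cases h : r < ‖x‖ ∧ ‖x‖ < R
  · rw [if_pos h, Set.indicator_of_mem (show ‖x‖ ∈ Set.Ioo r R from h), norm_smul, mul_pow,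
      Real.norm_eq_abs, sq_abs]
    have : ‖x‖ ≠ 0 := (hr.trans h.1).ne'
    field_simp
  · rw [if_neg h, Set.indicator_of_notMem (show ‖x‖ ∉ Set.Ioo r R from h)]
    simp

lemma norm_gf_sq_le {r R : ℝ} (hr : 0 < r) (x : E3) :
    ‖gf r R x‖ ^ 2 ≤ ((r⁻¹ - R⁻¹)⁻¹) ^ 2 / r ^ 4 := by
  rw [norm_gf_sq hr]
  by_cases h : ‖x‖ ∈ Set.Ioo r R
  · rw [Set.indicator_of_mem h]
    have := h.1.le
    gcongr
  · rw [Set.indicator_of_notMem h]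
    positivity

lemma hasDerivAt_vf {r R : ℝ} (hr : 0 < r) (hR : r < R) (x z : E3) (τ : ℝ)
    (h1 : ‖x + τ • z‖ ≠ r) (h2 : ‖x + τ • z‖ ≠ R) :
    HasDerivAt (fun τ : ℝ => vf r R (x + τ • z)) (inner ℝ (gf r R (x + τ • z)) z) τ := by
  have hc : Continuous (fun τ : ℝ => ‖x + τ • z‖) := by fun_prop
  rcases lt_or_gt_of_ne h1 with h1 | h1
  · have hg : gf r R (x + τ • z) = 0 := if_neg (fun h => by linarith [h.1])
    rw [hg, inner_zero_left]
    refine (hasDerivAt_const τ (1:ℝ)).congr_of_eventuallyEq ?_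
    filter_upwards [hc.continuousAt.eventually_lt_const h1] with t ht
    exact vf_of_le hr hR ht.le
  rcases lt_or_gt_of_ne h2 with h2 | h2
  · have hg : gf r R (x + τ • z) =
      (-(r⁻¹ - R⁻¹)⁻¹ / ‖x + τ • z‖ ^ 3) • (x + τ • z) := if_pos ⟨h1, h2⟩
    have hn : ‖x + τ • z‖ ≠ 0 := (hr.trans h1).ne'
    have hd : HasDerivAt (fun τ : ℝ => x + τ • z) z τ := by
      simpa using ((hasDerivAt_id τ).smul_const z).const_add x
    have hd2 := hd.norm_sq
    have hd3 := hd2.sqrt (by positivity)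
    simp only [Real.sqrt_sq (norm_nonneg _)] at hd3
    have hd4 := ((hd3.fun_inv hn).sub_const R⁻¹).div_const (r⁻¹ - R⁻¹)
    rw [hg, inner_smul_left]
    have : HasDerivAt (fun τ : ℝ => (‖x + τ • z‖⁻¹ - R⁻¹) / (r⁻¹ - R⁻¹))
      ((starRingEnd ℝ) (-(r⁻¹ - R⁻¹)⁻¹ / ‖x + τ • z‖ ^ 3) * inner ℝ (x + τ • z) z) τ := by
      refine hd4.congr_deriv ?_
      rw [conj_trivial]
      field_simp
    refine this.congr_of_eventuallyEq ?_
    filter_upwards [hc.continuousAt.eventually_lt_const h2,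
      hc.continuousAt.eventually_const_lt h1] with t ht ht'
    unfold vf
    rw [max_eq_left ht'.le, min_eq_left ht.le]
  · have hg : gf r R (x + τ • z) = 0 := if_neg (fun h => by linarith [h.2])
    rw [hg, inner_zero_left]
    refine (hasDerivAt_const τ (0:ℝ)).congr_of_eventuallyEq ?_
    filter_upwards [hc.continuousAt.eventually_const_lt h2] with t ht
    exact vf_of_ge hR ht.le

lemma vf_increment {r R : ℝ} (hr : 0 < r) (hR : r < R) (x z : E3) :
    ENNReal.ofReal ((vf r R (x + z) - vf r R x) ^ 2) ≤
      ∫⁻ τ in Set.Ioc (0:ℝ) 1, ENNReal.ofReal ((inner ℝ (gf r R (x + τ • z)) z) ^ 2) := by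
  by_cases hz : z = 0
  · simp [hz]
  set f : ℝ → ℝ := fun τ => inner ℝ (gf r R (x + τ • z)) z with hf
  have hfm : Measurable f := by
    have := (measurable_gf r R).comp (show Measurable (fun τ : ℝ => x + τ • z) by fun_prop)
    exact this.inner measurable_const
  set C := √(((r⁻¹ - R⁻¹)⁻¹) ^ 2 / r ^ 4) * ‖z‖
  have hfb : ∀ τ, ‖f τ‖ ≤ C := by
    intro τ
    refine (norm_inner_le_norm _ _).trans ?_
    exact mul_le_mul_of_nonneg_right (Real.le_sqrt_of_sq_le (norm_gf_sq_le hr _)) (norm_nonneg _)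
  have hfi : IntegrableOn f (Set.Ioc 0 1) := by
    refine Measure.integrableOn_of_bounded (M := C) (by simp) hfm.aestronglyMeasurable ?_
    exact Filter.Eventually.of_forall hfb
  have hf2i : IntegrableOn (fun τ => f τ ^ 2) (Set.Ioc 0 1) := by
    refine Measure.integrableOn_of_bounded (M := C ^ 2) (by simp)
      (hfm.pow_const 2).aestronglyMeasurable ?_
    refine Filter.Eventually.of_forall fun τ => ?_
    rw [norm_pow]
    have := hfb τ
    gcongr
  have hftc : ∫ τ in (0:ℝ)..1, f τ = vf r R (x + z) - vf r R x := by
    have := integral_eq_of_hasDerivAt_off_countable (fun τ : ℝ => vf r R (x + τ • z)) f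
      (a := 0) (b := 1) (s := {τ : ℝ | ‖x + τ • z‖ = r} ∪ {τ : ℝ | ‖x + τ • z‖ = R})
      (((finite_norm_eq x z hz r).union (finite_norm_eq x z hz R)).countable)
      (((continuous_vf hr hR).comp (by fun_prop : Continuous fun τ : ℝ => x + τ • z)).continuousOn)
      (by
        intro τ hτ
        have h := hτ.2
        simp only [Set.mem_union, Set.mem_ofPred_eq, not_or] at h
        exact hasDerivAt_vf hr hR x z τ h.1 h.2)
      ((intervalIntegrable_iff_integrableOn_Ioc_of_le zero_le_one).2 hfi)
    simpa using this
  rw [intervalIntegral.integral_of_le zero_le_one] at hftc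
  rw [← ofReal_integral_eq_lintegral_ofReal hf2i (Filter.Eventually.of_forall fun τ => sq_nonneg _)]
  apply ENNReal.ofReal_le_ofReal
  rw [← hftc]
  set m := ∫ τ in Set.Ioc (0:ℝ) 1, f τ
  have hnn : 0 ≤ ∫ τ in Set.Ioc (0:ℝ) 1, (f τ - m) ^ 2 := integral_nonneg fun τ => sq_nonneg _
  have hexp : ∫ τ in Set.Ioc (0:ℝ) 1, (f τ - m) ^ 2
      = (∫ τ in Set.Ioc (0:ℝ) 1, f τ ^ 2) - 2 * m * m + m ^ 2 := by
    have : ∀ τ, (f τ - m) ^ 2 = (f τ ^ 2 - 2 * m * f τ) + m ^ 2 := by intro τ; ring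
    simp_rw [this]
    have hi3 : IntegrableOn (fun τ => 2 * m * f τ) (Set.Ioc 0 1) := hfi.const_mul _
    have hi4 : IntegrableOn (fun τ => f τ ^ 2 - 2 * m * f τ) (Set.Ioc 0 1) := hf2i.sub hi3
    have hi5 : IntegrableOn (fun τ : ℝ => m ^ 2) (Set.Ioc 0 1) := by simp
    rw [integral_add hi4 hi5, integral_sub hf2i hi3, integral_const_mul]
    simp [m]
  nlinarith

lemma lintegral_gf_sq {r R : ℝ} (hr : 0 < r) (hR : r < R) :
    ∫⁻ x : E3, ENNReal.ofReal (‖gf r R x‖ ^ 2) = ENNReal.ofReal (4 * π / (r⁻¹ - R⁻¹)) := by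
  have h := (inv_lt_inv₀ (hr.trans hR) hr).2 hR
  have h' : 0 < r⁻¹ - R⁻¹ := by linarith
  apply lintegral_ofReal_of_integral (Filter.Eventually.of_forall fun x => sq_nonneg _)
    (by positivity)
  simp_rw [norm_gf_sq hr]
  rw [integral_fun_norm_addHaar volume]
  simp only [finrank_euclideanSpace, Fintype.card_fin, smul_eq_mul, nsmul_eq_mul, Measure.real,
    EuclideanSpace.volume_ball_fin_three]
  have h5 : (ENNReal.ofReal 1 ^ 3 * ENNReal.ofReal (π * 4 / 3)).toReal = π * 4 / 3 := by
    simp; positivity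
  rw [h5]
  have h6 : ∀ y : ℝ, y ^ (3 - 1) * (Set.Ioo r R).indicator (fun ρ => ((r⁻¹ - R⁻¹)⁻¹) ^ 2 / ρ ^ 4) y
      = (Set.Ioo r R).indicator (fun ρ => ((r⁻¹ - R⁻¹)⁻¹) ^ 2 * (ρ ^ 2)⁻¹) y := by
    intro y
    by_cases hy : y ∈ Set.Ioo r R
    · rw [Set.indicator_of_mem hy, Set.indicator_of_mem hy]
      have : y ≠ 0 := (hr.trans hy.1).ne'
      field_simp
    · rw [Set.indicator_of_notMem hy, Set.indicator_of_notMem hy]; simp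
  simp_rw [h6]
  rw [setIntegral_indicator measurableSet_Ioo]
  have h7 : Set.Ioi 0 ∩ Set.Ioo r R = Set.Ioo r R := by
    ext y; simp only [Set.mem_inter_iff, Set.mem_Ioi, Set.mem_Ioo]
    constructor
    · exact fun h => h.2
    · exact fun h => ⟨hr.trans h.1, h⟩
  rw [h7, integral_const_mul, ← integral_Ioc_eq_integral_Ioo,
    ← intervalIntegral.integral_of_le hR.le]
  have h8 : ∫ ρ in r..R, (ρ ^ 2)⁻¹ = r⁻¹ - R⁻¹ := by
    have hne : ∀ ρ ∈ Set.uIcc r R, ρ ≠ 0 := by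
      intro ρ hρ
      rw [Set.uIcc_of_le hR.le] at hρ
      exact (hr.trans_le hρ.1).ne'
    rw [intervalIntegral.integral_eq_sub_of_hasDerivAt (f := fun ρ => -ρ⁻¹)]
    · ring
    · intro ρ hρ
      simpa using (hasDerivAt_inv (hne ρ hρ)).fun_neg
    · apply ContinuousOn.intervalIntegrable
      apply ContinuousOn.inv₀ (by fun_prop)
      intro ρ hρ
      exact pow_ne_zero 2 (hne ρ hρ)
  rw [h8]
  push_cast
  field_simp

lemma energy_vf {r R s : ℝ} (hs : 0 < s) (hr : 0 < r) (hR : r < R) :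
    ∫⁻ x, ∫⁻ y, pE s x y * ENNReal.ofReal ((vf r R x - vf r R y) ^ 2)
      ≤ ENNReal.ofReal (s * (4 * π / (r⁻¹ - R⁻¹))) := by
  have hvm : Measurable (vf r R) := (continuous_vf hr hR).measurable
  have hpm : Measurable fun z : E3 => ENNReal.ofReal (pd s ‖z‖) :=
    (measurable_pd.comp (measurable_const.prodMk (by fun_prop))).ennreal_ofReal
  have hgm := measurable_gf r R
  calc _ = ∫⁻ x, ∫⁻ z, ENNReal.ofReal (pd s ‖z‖) *
          ENNReal.ofReal ((vf r R (x + z) - vf r R x) ^ 2) := by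
        congr 1; ext x
        rw [← lintegral_add_left_eq_self _ x]
        congr 1; ext z
        rw [pE, heatKernel_eq_pd]
        congr 2
        · simp
        · ring_nf
    _ = ∫⁻ z, ∫⁻ x, ENNReal.ofReal (pd s ‖z‖) *
          ENNReal.ofReal ((vf r R (x + z) - vf r R x) ^ 2) := by
        rw [lintegral_lintegral_swap]
        apply Measurable.aemeasurable
        unfold Function.uncurry
        exact (hpm.comp measurable_snd).mul (by fun_prop)
    _ ≤ ∫⁻ z, ∫⁻ x, ENNReal.ofReal (pd s ‖z‖) *
          ENNReal.ofReal ((inner ℝ (gf r R x) z) ^ 2) := by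
        apply lintegral_mono; intro z; dsimp only
        rw [lintegral_const_mul' _ _ (by simp), lintegral_const_mul' _ _ (by simp)]
        refine mul_le_mul_right ?_ _
        calc _ ≤ ∫⁻ x, ∫⁻ τ in Set.Ioc (0:ℝ) 1,
                ENNReal.ofReal ((inner ℝ (gf r R (x + τ • z)) z) ^ 2) :=
              lintegral_mono fun x => vf_increment hr hR x z
          _ = ∫⁻ τ in Set.Ioc (0:ℝ) 1, ∫⁻ x,
                ENNReal.ofReal ((inner ℝ (gf r R (x + τ • z)) z) ^ 2) := by
              rw [lintegral_lintegral_swap]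
              apply Measurable.aemeasurable
              unfold Function.uncurry
              have : Measurable fun q : E3 × ℝ => gf r R (q.1 + q.2 • z) :=
                hgm.comp (by fun_prop)
              exact ((this.inner measurable_const).pow_const 2).ennreal_ofReal
          _ = ∫⁻ τ in Set.Ioc (0:ℝ) 1, ∫⁻ x,
                ENNReal.ofReal ((inner ℝ (gf r R x) z) ^ 2) := by
              congr 1; ext τ
              exact lintegral_add_right_eq_self
                (fun x => ENNReal.ofReal ((inner ℝ (gf r R x) z) ^ 2)) (τ • z)
          _ = _ := by simp
    _ = ∫⁻ x, ∫⁻ z, ENNReal.ofReal (pd s ‖z‖) *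
          ENNReal.ofReal ((inner ℝ (gf r R x) z) ^ 2) := by
        rw [lintegral_lintegral_swap]
        apply Measurable.aemeasurable
        unfold Function.uncurry
        refine (hpm.comp measurable_fst).mul ?_
        exact (((hgm.comp measurable_snd).inner measurable_fst).pow_const 2).ennreal_ofReal
    _ = ∫⁻ x, ENNReal.ofReal s * ENNReal.ofReal (‖gf r R x‖ ^ 2) := by
        congr 1; ext x
        simp_rw [← ENNReal.ofReal_mul (pd_nonneg hs.le _)]
        rw [lintegral_inner_sq hs, ENNReal.ofReal_mul hs.le]
    _ = _ := by
        rw [lintegral_const_mul' _ _ (by simp), lintegral_gf_sq hr hR, ← ENNReal.ofReal_mul hs.le]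

end LoopCross

open MeasureTheory Real
open scoped ENNReal

namespace LoopCross

def sI (r : ℝ) : Set E3 := {x | ‖x‖ < r}
def sO (R : ℝ) : Set E3 := {x | R < ‖x‖}
def sD (r R : ℝ) : Set E3 := {x | r ≤ ‖x‖ ∧ ‖x‖ ≤ R}

lemma msI (r : ℝ) : MeasurableSet (sI r) := measurableSet_lt measurable_norm measurable_const
lemma msO (R : ℝ) : MeasurableSet (sO R) := measurableSet_lt measurable_const measurable_norm
lemma msD (r R : ℝ) : MeasurableSet (sD r R) :=
  (measurableSet_le measurable_const measurable_norm).inter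
    (measurableSet_le measurable_norm measurable_const)

noncomputable def iI (r : ℝ) : E3 → ℝ≥0∞ := (sI r).indicator 1
noncomputable def iO (R : ℝ) : E3 → ℝ≥0∞ := (sO R).indicator 1
noncomputable def iD (r R : ℝ) : E3 → ℝ≥0∞ := (sD r R).indicator 1

lemma measurable_iI (r : ℝ) : Measurable (iI r) := measurable_one.indicator (msI r)
lemma measurable_iO (R : ℝ) : Measurable (iO R) := measurable_one.indicator (msO R)
lemma measurable_iD (r R : ℝ) : Measurable (iD r R) := measurable_one.indicator (msD r R)

/-- probability that the first visit to the inner ball happens at step `m+1`,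
all earlier steps lying in the shell -/
noncomputable def kap (s r R : ℝ) : ℕ → E3 → ℝ≥0∞
  | 0, x => ∫⁻ y, pE s x y * iI r y
  | (m+1), x => ∫⁻ y, pE s x y * (iD r R y * kap s r R m y)

lemma measurable_kap (s r R : ℝ) (m : ℕ) : Measurable (kap s r R m) := by
  induction m with
  | zero =>
    apply Measurable.lintegral_prod_right' (f := fun q : E3 × E3 => pE s q.1 q.2 * iI r q.2)
    exact (Measurable.pE' measurable_const measurable_fst measurable_snd).mul
      ((measurable_iI r).comp measurable_snd)
  | succ m ih =>
    apply Measurable.lintegral_prod_right'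
      (f := fun q : E3 × E3 => pE s q.1 q.2 * (iD r R q.2 * kap s r R m q.2))
    exact (Measurable.pE' measurable_const measurable_fst measurable_snd).mul
      (((measurable_iD r R).comp measurable_snd).mul (ih.comp measurable_snd))

noncomputable def Uf (s r R : ℝ) (x : E3) : ℝ≥0∞ := ∑' m, kap s r R m x
noncomputable def uf (s r R : ℝ) (x : E3) : ℝ≥0∞ := iI r x + iD r R x * Uf s r R x

lemma measurable_Uf (s r R : ℝ) : Measurable (Uf s r R) :=
  Measurable.tsum (measurable_kap s r R)

lemma measurable_uf (s r R : ℝ) : Measurable (uf s r R) :=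
  (measurable_iI r).add ((measurable_iD r R).mul (measurable_Uf s r R))

lemma measurable_pE_right (s : ℝ) (x : E3) : Measurable (pE s x) :=
  Measurable.pE' measurable_const measurable_const measurable_id

lemma meas_pI (s r : ℝ) (x : E3) : Measurable fun y => pE s x y * iI r y :=
  (measurable_pE_right s x).mul (measurable_iI r)

lemma meas_pD (s r R : ℝ) (x : E3) {f : E3 → ℝ≥0∞} (hf : Measurable f) :
    Measurable fun y => pE s x y * (iD r R y * f y) :=
  (measurable_pE_right s x).mul ((measurable_iD r R).mul hf)

lemma Uf_eq (s r R : ℝ) (x : E3) : Uf s r R x = ∫⁻ y, pE s x y * uf s r R y := by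
  unfold Uf
  rw [tsum_eq_zero_add' ENNReal.summable]
  simp only [uf, Uf, kap, mul_add, ← ENNReal.tsum_mul_left]
  rw [lintegral_add_left (meas_pI s r x), lintegral_tsum]
  intro m
  exact (meas_pD s r R x (measurable_kap s r R m)).aemeasurable

lemma partial_le_one {s r R : ℝ} (hs : 0 < s) (M : ℕ) (x : E3) :
    ∑ m ∈ Finset.range M, kap s r R m x ≤ 1 := by
  induction M generalizing x with
  | zero => simp
  | succ M ih =>
    rw [Finset.sum_range_succ']
    simp only [kap]
    rw [← lintegral_finsetSum _ (fun m _ => meas_pD s r R x (measurable_kap s r R m)),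
      ← lintegral_add_right _ (meas_pI s r x), ← lintegral_pE hs x]
    apply lintegral_mono
    intro y
    simp only [← Finset.mul_sum]
    rw [← mul_add]
    conv_rhs => rw [← mul_one (pE s x y)]
    refine mul_le_mul_right ?_ _
    by_cases hI : y ∈ sI r
    · have hD : y ∉ sD r R := fun h => absurd h.1 (not_le.2 hI)
      simp [iI, iD, hI, hD]
    · by_cases hD : y ∈ sD r R
      · simpa [iI, iD, hI, hD] using ih y
      · simp [iI, iD, hI, hD]

lemma Uf_le_one {s r R : ℝ} (hs : 0 < s) (x : E3) : Uf s r R x ≤ 1 := by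
  unfold Uf
  rw [ENNReal.tsum_eq_iSup_nat]
  exact iSup_le fun M => partial_le_one hs M x

lemma uf_le {s r R : ℝ} (hs : 0 < s) (hR : r < R) (x : E3) :
    uf s r R x ≤ (Metric.closedBall (0:E3) R).indicator 1 x := by
  unfold uf
  by_cases hI : x ∈ sI r
  · have hD : x ∉ sD r R := fun h => absurd h.1 (not_le.2 hI)
    have : x ∈ Metric.closedBall (0:E3) R := by
      simpa using (show ‖x‖ < r from hI).le.trans hR.le
    rw [Set.indicator_of_mem this]
    simp [iI, iD, hI, hD]
  · by_cases hD : x ∈ sD r R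
    · have : x ∈ Metric.closedBall (0:E3) R := by simpa using hD.2
      rw [Set.indicator_of_mem this]
      simpa [iI, iD, hI, hD] using Uf_le_one hs x
    · simp [iI, iD, hI, hD]

section dirichlet

lemma integrable_kernel_mul {s : ℝ} (hs : 0 < s) {a : E3 → ℝ} (ha : Integrable a)
    (ham : Measurable a) :
    Integrable (fun q : E3 × E3 => heatKernel 3 s q.1 q.2 * a q.1) (volume.prod volume) := by
  have hkm : Measurable fun q : E3 × E3 => heatKernel 3 s q.1 q.2 := by
    unfold heatKernel; fun_prop
  refine ⟨(hkm.mul (ham.comp measurable_fst)).aestronglyMeasurable, ?_⟩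
  rw [hasFiniteIntegral_iff_enorm, lintegral_prod _ (by fun_prop)]
  have : ∀ x y : E3, ‖heatKernel 3 s x y * a x‖ₑ = ‖a x‖ₑ * pE s x y := by
    intro x y
    have h0 : 0 ≤ heatKernel 3 s x y := by rw [heatKernel_eq_pd]; exact pd_nonneg hs.le _
    rw [enorm_mul, mul_comm, pE, Real.enorm_of_nonneg h0]
  simp_rw [this]
  simp_rw [lintegral_const_mul _ (measurable_pE_right s _), lintegral_pE hs, mul_one]
  exact ha.2

lemma heatKernel_symm (s : ℝ) (x y : E3) : heatKernel 3 s x y = heatKernel 3 s y x := by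
  simp [heatKernel_eq_pd, norm_sub_rev]

lemma integrable_kernel_mul' {s : ℝ} (hs : 0 < s) {a : E3 → ℝ} (ha : Integrable a)
    (ham : Measurable a) :
    Integrable (fun q : E3 × E3 => heatKernel 3 s q.1 q.2 * a q.2) (volume.prod volume) := by
  have := (integrable_kernel_mul hs ha ham).swap
  refine this.congr (Filter.Eventually.of_forall fun q => ?_)
  simp [heatKernel_symm s q.1 q.2]

lemma integral_kernel {s : ℝ} (hs : 0 < s) (x : E3) : ∫ y, heatKernel 3 s x y = 1 := by
  rw [integral_eq_lintegral_of_nonneg_ae]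
  · have := lintegral_pE hs x
    simp only [pE] at this
    simp [this]
  · exact Filter.Eventually.of_forall fun y => by
      simp only [heatKernel_eq_pd]; exact pd_nonneg hs.le _
  · apply Measurable.aestronglyMeasurable
    unfold heatKernel; fun_prop

/-- Discrete Dirichlet principle in abstract form. -/
lemma dirichlet_aux {s r R : ℝ} (hs : 0 < s) (hr : 0 < r) (hR : r < R) {u U v : E3 → ℝ}
    (hum : Measurable u) (hUm : Measurable U) (hvm : Measurable v)
    (hu : ∀ x, 0 ≤ u x ∧ u x ≤ 1) (hv : ∀ x, 0 ≤ v x ∧ v x ≤ 1)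
    (hui : Integrable u) (hvi : Integrable v)
    (hU : ∀ x, ∫ y, heatKernel 3 s x y * u y = U x)
    (hI : ∀ x ∈ sI r, u x = 1 ∧ v x = 1) (hO : ∀ x ∈ sO R, u x = 0 ∧ v x = 0)
    (hD : ∀ x ∈ sD r R, u x = U x) :
    IntegrableOn U (sO R) ∧
    2 * ENNReal.ofReal (∫ x in sO R, U x) ≤
      ∫⁻ x, ∫⁻ y, pE s x y * ENNReal.ofReal ((v x - v y) ^ 2) := by
  set k : E3 × E3 → ℝ := fun q => heatKernel 3 s q.1 q.2 with hk
  have hk0 : ∀ q, 0 ≤ k q := fun q => by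
    simp only [hk, heatKernel_eq_pd]; exact pd_nonneg hs.le _
  have hkm : Measurable k := by
    simp only [hk]; unfold heatKernel; fun_prop
  have hu1 := integrable_kernel_mul hs hui hum
  have hu2 := integrable_kernel_mul' hs hui hum
  have hv1 := integrable_kernel_mul hs hvi hvm
  have hv2 := integrable_kernel_mul' hs hvi hvm
  set w : E3 → ℝ := fun x => 2 * v x - u x - 1 with hw
  have hwm : Measurable w := by simp only [hw]; fun_prop
  have hwb : ∀ x, ‖w x‖ ≤ 2 := by
    intro x
    have := hu x; have := hv x
    rw [Real.norm_eq_abs, abs_le]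
    simp only [hw]
    constructor <;> linarith
  have b11 : Integrable (fun q : E3 × E3 => k q * u q.1 * w q.1) (volume.prod volume) :=
    hu1.mul_bdd (c := 2) (hwm.comp measurable_fst).aestronglyMeasurable
      (Filter.Eventually.of_forall fun q => hwb _)
  have b12 : Integrable (fun q : E3 × E3 => k q * u q.1 * w q.2) (volume.prod volume) :=
    hu1.mul_bdd (c := 2) (hwm.comp measurable_snd).aestronglyMeasurable
      (Filter.Eventually.of_forall fun q => hwb _)
  have b21 : Integrable (fun q : E3 × E3 => k q * u q.2 * w q.1) (volume.prod volume) :=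
    hu2.mul_bdd (c := 2) (hwm.comp measurable_fst).aestronglyMeasurable
      (Filter.Eventually.of_forall fun q => hwb _)
  have b22 : Integrable (fun q : E3 × E3 => k q * u q.2 * w q.2) (volume.prod volume) :=
    hu2.mul_bdd (c := 2) (hwm.comp measurable_snd).aestronglyMeasurable
      (Filter.Eventually.of_forall fun q => hwb _)
  have hvb : ∀ q : E3 × E3, ‖v q.1 - v q.2‖ ≤ 2 := by
    intro q
    have := hv q.1; have := hv q.2
    rw [Real.norm_eq_abs, abs_le]
    constructor <;> linarith
  have c1 : Integrable (fun q : E3 × E3 => k q * v q.1 * (v q.1 - v q.2)) (volume.prod volume) :=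
    hv1.mul_bdd (c := 2) (by fun_prop) (Filter.Eventually.of_forall hvb)
  have c2 : Integrable (fun q : E3 × E3 => k q * v q.2 * (v q.1 - v q.2)) (volume.prod volume) :=
    hv2.mul_bdd (c := 2) (by fun_prop) (Filter.Eventually.of_forall hvb)
  have hF : Integrable (fun q : E3 × E3 => k q * (v q.1 - v q.2) ^ 2) (volume.prod volume) := by
    refine (c1.sub c2).congr (Filter.Eventually.of_forall fun q => ?_)
    simp only [Pi.sub_apply]; ring
  -- the four integrals
  have hUi : Integrable U := by
    have := hu2.integral_prod_left
    refine this.congr (Filter.Eventually.of_forall fun x => ?_)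
    exact hU x
  have huw : Integrable (fun x => u x * w x) :=
    hui.mul_bdd (c := 2) hwm.aestronglyMeasurable (Filter.Eventually.of_forall hwb)
  have hUw : Integrable (fun x => U x * w x) :=
    hUi.mul_bdd (c := 2) hwm.aestronglyMeasurable (Filter.Eventually.of_forall hwb)
  have e11 : ∫ q : E3 × E3, k q * u q.1 * w q.1 ∂(volume.prod volume) = ∫ x, u x * w x := by
    rw [integral_prod _ b11]
    congr 1; ext x
    simp only [hk]
    simp_rw [mul_assoc]
    rw [integral_mul_const, integral_kernel hs, one_mul]
  have e21 : ∫ q : E3 × E3, k q * u q.2 * w q.1 ∂(volume.prod volume) = ∫ x, U x * w x := by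
    rw [integral_prod _ b21]
    congr 1; ext x
    simp only [hk]
    rw [integral_mul_const, hU]
  have e22 : ∫ q : E3 × E3, k q * u q.2 * w q.2 ∂(volume.prod volume) = ∫ x, u x * w x := by
    rw [← e11, ← integral_prod_swap]
    congr 1; ext q
    simp [hk, heatKernel_symm s q.1 q.2]
  have e12 : ∫ q : E3 × E3, k q * u q.1 * w q.2 ∂(volume.prod volume) = ∫ x, U x * w x := by
    rw [← e21, ← integral_prod_swap]
    congr 1; ext q
    simp [hk, heatKernel_symm s q.1 q.2]
  have hG : Integrable (fun q : E3 × E3 => k q * u q.1 * w q.1 - k q * u q.1 * w q.2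
      - k q * u q.2 * w q.1 + k q * u q.2 * w q.2) (volume.prod volume) :=
    ((b11.sub b12).sub b21).add b22
  have hGint : ∫ q : E3 × E3, (k q * u q.1 * w q.1 - k q * u q.1 * w q.2
      - k q * u q.2 * w q.1 + k q * u q.2 * w q.2) ∂(volume.prod volume)
      = 2 * ∫ x, (u x * w x - U x * w x) := by
    rw [integral_add (f := fun q : E3 × E3 => k q * u q.1 * w q.1 - k q * u q.1 * w q.2
      - k q * u q.2 * w q.1) ((b11.sub b12).sub b21) b22,
      integral_sub (f := fun q : E3 × E3 => k q * u q.1 * w q.1 - k q * u q.1 * w q.2)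
        (b11.sub b12) b21, integral_sub b11 b12, e11, e12, e21, e22,
      integral_sub huw hUw]
    ring
  have hpt : ∀ x, u x * w x - U x * w x = (sO R).indicator U x := by
    intro x
    by_cases h1 : x ∈ sI r
    · have : x ∉ sO R := fun h => absurd (show R < ‖x‖ from h)
        (not_lt.2 ((show ‖x‖ < r from h1).le.trans hR.le))
      rw [Set.indicator_of_notMem this]
      simp only [hw, (hI x h1).1, (hI x h1).2]; ring
    · by_cases h2 : x ∈ sO R
      · rw [Set.indicator_of_mem h2]
        simp only [hw, (hO x h2).1, (hO x h2).2]; ring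
      · rw [Set.indicator_of_notMem h2, ← hD x ⟨not_lt.1 h1, not_lt.1 h2⟩]; ring
  simp_rw [hpt, integral_indicator (msO R)] at hGint
  refine ⟨hUi.integrableOn, ?_⟩
  have hle : 2 * ∫ x in sO R, U x ≤ ∫ q : E3 × E3, k q * (v q.1 - v q.2) ^ 2
      ∂(volume.prod volume) := by
    rw [← hGint]
    refine integral_mono hG hF fun q => ?_
    have h1 := hk0 q
    have h2 : 0 ≤ k q * ((v q.1 - v q.2) - (u q.1 - u q.2)) ^ 2 := by positivity
    simp only [hw]
    nlinarith
  calc 2 * ENNReal.ofReal (∫ x in sO R, U x) = ENNReal.ofReal (2 * ∫ x in sO R, U x) := by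
        rw [ENNReal.ofReal_mul (by norm_num)]; simp
    _ ≤ ENNReal.ofReal (∫ q : E3 × E3, k q * (v q.1 - v q.2) ^ 2 ∂(volume.prod volume)) :=
        ENNReal.ofReal_le_ofReal hle
    _ = ∫⁻ q : E3 × E3, ENNReal.ofReal (k q * (v q.1 - v q.2) ^ 2) ∂(volume.prod volume) :=
        ofReal_integral_eq_lintegral_ofReal hF
          (Filter.Eventually.of_forall fun q => mul_nonneg (hk0 q) (sq_nonneg _))
    _ = _ := by
        rw [lintegral_prod _ (by fun_prop)]
        simp_rw [ENNReal.ofReal_mul (hk0 _)]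
        rfl

end dirichlet

lemma integrable_of_le_indicator {R : ℝ} {f : E3 → ℝ} (hf : Measurable f)
    (h0 : ∀ x, 0 ≤ f x ∧ f x ≤ 1) (h1 : ∀ x, R < ‖x‖ → f x = 0) : Integrable f := by
  have hi : Integrable ((Metric.closedBall (0:E3) R).indicator (fun _ => (1:ℝ))) := by
    rw [integrable_indicator_iff measurableSet_closedBall]
    exact integrableOn_const (isCompact_closedBall (0:E3) R).measure_lt_top.ne
  refine hi.mono' hf.aestronglyMeasurable (Filter.Eventually.of_forall fun x => ?_)
  rw [Real.norm_of_nonneg (h0 x).1]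
  by_cases hx : R < ‖x‖
  · rw [h1 x hx]
    exact Set.indicator_nonneg (fun _ _ => zero_le_one) _
  · rw [Set.indicator_of_mem (by simpa using hx)]
    exact (h0 x).2

lemma lintegral_Uf_le {s r R : ℝ} (hs : 0 < s) (hr : 0 < r) (hR : r < R) :
    ∫⁻ x in sO R, Uf s r R x ≤ ENNReal.ofReal (s * (2 * π / (r⁻¹ - R⁻¹))) := by
  have hUle := fun x => Uf_le_one (r := r) (R := R) hs x
  have hule : ∀ x, uf s r R x ≤ 1 := fun x => (uf_le hs hR x).trans
    (Set.indicator_le_self' (fun _ _ => bot_le) x)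
  have hUt : ∀ x, Uf s r R x ≠ ∞ := fun x => ((hUle x).trans_lt ENNReal.one_lt_top).ne
  have hut : ∀ x, uf s r R x ≠ ∞ := fun x => ((hule x).trans_lt ENNReal.one_lt_top).ne
  have hum : Measurable fun x => (uf s r R x).toReal := (measurable_uf s r R).ennreal_toReal
  have hu01 : ∀ x, 0 ≤ (uf s r R x).toReal ∧ (uf s r R x).toReal ≤ 1 := fun x =>
    ⟨ENNReal.toReal_nonneg, by simpa using ENNReal.toReal_mono (by simp) (hule x)⟩
  have huO : ∀ x, R < ‖x‖ → uf s r R x = 0 := by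
    intro x hx
    have := uf_le (s := s) hs hR x
    rw [Set.indicator_of_notMem (by simpa using hx)] at this
    simpa using this
  have hvm := (continuous_vf hr hR).measurable
  have key := dirichlet_aux (s := s) (r := r) (R := R) hs hr hR
    (u := fun x => (uf s r R x).toReal) (U := fun x => (Uf s r R x).toReal) (v := vf r R)
    hum (measurable_Uf s r R).ennreal_toReal hvm hu01 (vf_mem hr hR)
    (integrable_of_le_indicator (R := R) hum hu01 fun x hx => by simp [huO x hx])
    (integrable_of_le_indicator (R := R) hvm (vf_mem hr hR) fun x hx => vf_of_ge hR hx.le)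
    (by
      intro x
      rw [integral_eq_lintegral_of_nonneg_ae]
      · rw [Uf_eq]
        congr 1
        apply lintegral_congr
        intro y
        rw [ENNReal.ofReal_mul, ENNReal.ofReal_toReal (hut y)]
        · rfl
        · rw [heatKernel_eq_pd]; exact pd_nonneg hs.le _
      · refine Filter.Eventually.of_forall fun y => mul_nonneg ?_ ENNReal.toReal_nonneg
        rw [heatKernel_eq_pd]; exact pd_nonneg hs.le _
      · refine (Measurable.mul ?_ hum).aestronglyMeasurable
        unfold heatKernel; fun_prop)
    (by
      intro x hx
      refine ⟨?_, vf_of_le hr hR (le_of_lt hx)⟩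
      have hD : x ∉ sD r R := fun h => absurd h.1 (not_le.2 hx)
      simp [uf, iI, iD, hx, hD])
    (by
      intro x hx
      exact ⟨by simp [huO x hx], vf_of_ge hR (le_of_lt hx)⟩)
    (by
      intro x hx
      have hI : x ∉ sI r := fun h => absurd hx.1 (not_le.2 h)
      simp [uf, iI, iD, hx, hI])
  obtain ⟨hi, hle⟩ := key
  have h2 := hle.trans (energy_vf hs hr hR)
  rw [ofReal_integral_eq_lintegral_ofReal hi
    (Filter.Eventually.of_forall fun x => ENNReal.toReal_nonneg)] at h2
  simp_rw [ENNReal.ofReal_toReal (hUt _)] at h2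
  have h3 : ENNReal.ofReal (s * (4 * π / (r⁻¹ - R⁻¹)))
      = 2 * ENNReal.ofReal (s * (2 * π / (r⁻¹ - R⁻¹))) := by
    rw [show (2:ℝ≥0∞) = ENNReal.ofReal 2 by simp, ← ENNReal.ofReal_mul (by norm_num)]
    congr 1; ring
  rw [h3] at h2
  exact (ENNReal.mul_le_mul_iff_right (by simp) (by simp)).1 h2

end LoopCross

open MeasureTheory Real
open scoped ENNReal

namespace LoopCross

/-- Lebesgue measure on `(ℝ³)^k` -/
noncomputable abbrev vk (k : ℕ) : Measure (Fin k → E3) :=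
  Measure.pi fun _ : Fin k => (volume : Measure E3)

lemma lintegral_cons {k : ℕ} {f : (Fin (k+1) → E3) → ℝ≥0∞} (hf : Measurable f) :
    ∫⁻ y, f y ∂(vk (k+1)) = ∫⁻ x, ∫⁻ z, f (Fin.cons x z) ∂(vk k) := by
  have h := (measurePreserving_piFinSuccAbove (fun _ : Fin (k+1) => (volume : Measure E3)) 0).symm
  rw [← h.lintegral_comp hf, lintegral_prod]
  · refine lintegral_congr fun x => lintegral_congr fun z => ?_
    rw [MeasurableEquiv.piFinSuccAbove_symm_apply]
    simp only [Fin.insertNthEquiv, Equiv.coe_fn_mk, Fin.insertNth_zero]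
    rfl
  · exact (hf.comp (MeasurableEquiv.measurable _)).aemeasurable

lemma measurable_cons {k : ℕ} : Measurable
    (fun q : E3 × (Fin k → E3) => (Fin.cons q.1 q.2 : Fin (k+1) → E3)) := by
  rw [measurable_pi_iff]
  intro i
  refine Fin.cases ?_ (fun j => ?_) i
  · simpa using measurable_fst
  · simp only [Fin.cons_succ]; fun_prop

lemma measurable_tail {k : ℕ} : Measurable (fun z : Fin (k+1) → E3 => Fin.tail z) := by
  rw [measurable_pi_iff]
  intro i
  simp only [Fin.tail]; fun_prop

/-- product of heat kernels along a path -/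
noncomputable def chain (s : ℝ) : (k : ℕ) → E3 → (Fin k → E3) → E3 → ℝ≥0∞
  | 0, x, _, x' => pE s x x'
  | (k+1), x, z, x' => pE s x (z 0) * chain s k (z 0) (Fin.tail z) x'

/-- indicator that the first exit from the shell is into the inner ball -/
noncomputable def ck (r R : ℝ) : (k : ℕ) → (Fin k → E3) → ℝ≥0∞
  | 0, _ => 0
  | (k+1), z => iI r (z 0) + iD r R (z 0) * ck r R k (Fin.tail z)

lemma measurable_chain (k : ℕ) : Measurable
    (fun q : ℝ × E3 × (Fin k → E3) × E3 => chain q.1 k q.2.1 q.2.2.1 q.2.2.2) := by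
  induction k with
  | zero => exact Measurable.pE' (by fun_prop) (by fun_prop) (by fun_prop)
  | succ k ih =>
    simp only [chain]
    refine (Measurable.pE' (by fun_prop) (by fun_prop) (by fun_prop)).mul ?_
    have hg : Measurable fun q : ℝ × E3 × (Fin (k+1) → E3) × E3 =>
        (q.1, q.2.2.1 0, (Fin.tail q.2.2.1 : Fin k → E3), q.2.2.2) := by
      refine Measurable.prodMk (by fun_prop) (Measurable.prodMk (by fun_prop)
        (Measurable.prodMk ?_ (by fun_prop)))
      exact measurable_tail.comp (by fun_prop)
    exact ih.comp hg

lemma Measurable.chain' {α : Type*} [MeasurableSpace α] {k : ℕ} {a : α → ℝ} {b c : α → E3}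
    {z : α → (Fin k → E3)} (ha : Measurable a) (hb : Measurable b) (hz : Measurable z)
    (hc : Measurable c) : Measurable (fun q => chain (a q) k (b q) (z q) (c q)) :=
  (measurable_chain k).comp (ha.prodMk (hb.prodMk (hz.prodMk hc)))

lemma measurable_ck (r R : ℝ) (k : ℕ) : Measurable (ck r R k) := by
  induction k with
  | zero => exact measurable_const
  | succ k ih =>
    simp only [ck]
    have h0 : Measurable fun z : Fin (k+1) → E3 => z 0 := measurable_pi_apply 0
    exact ((measurable_iI r).comp h0).add
      (((measurable_iD r R).comp h0).mul (ih.comp measurable_tail))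

lemma chain_total {s : ℝ} (hs : 0 < s) (k : ℕ) (x x' : E3) :
    ∫⁻ z, chain s k x z x' ∂(vk k) = pE (((k:ℝ) + 1) * s) x x' := by
  induction k generalizing x with
  | zero => simp [chain]
  | succ k ih =>
    have hm : Measurable fun z : Fin (k+1) → E3 => chain s (k+1) x z x' :=
      Measurable.chain' measurable_const measurable_const measurable_id measurable_const
    rw [lintegral_cons hm]
    simp only [chain, Fin.cons_zero, Fin.tail_cons]
    have : ∀ z0 : E3, ∫⁻ z, pE s x z0 * chain s k z0 z x' ∂(vk k)
        = pE s x z0 * pE (((k:ℝ) + 1) * s) z0 x' := by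
      intro z0
      rw [lintegral_const_mul' _ _ (by simp [pE]), ih]
    simp_rw [this]
    rw [lintegral_pE_mul hs (by positivity)]
    congr 1; push_cast; ring

lemma pE_le_pd {s r R : ℝ} (hs : 0 < s) (hR : r < R) {y x' : E3} (hy : y ∈ sI r) (hx : x' ∈ sO R) :
    pE s y x' ≤ ENNReal.ofReal (pd s (R - r)) := by
  unfold pE
  rw [heatKernel_eq_pd]
  apply ENNReal.ofReal_le_ofReal
  apply pd_anti hs (by linarith)
  have h1 : ‖y‖ < r := hy
  have h2 : R < ‖x'‖ := hx
  have h3 := norm_sub_norm_le x' y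
  rw [norm_sub_rev] at h3
  linarith

/-- crossing part of the path integral -/
noncomputable def Phi (s r R : ℝ) (k : ℕ) (x x' : E3) : ℝ≥0∞ :=
  ∫⁻ z, chain s k x z x' * ck r R k z ∂(vk k)

lemma Phi_le {s r R : ℝ} (hs : 0 < s) (hR : r < R) (k : ℕ) (x x' : E3) (hx : x' ∈ sO R) :
    Phi s r R k x x' ≤ ∑ m ∈ Finset.range k,
      ENNReal.ofReal (pd (((k - m : ℕ) : ℝ) * s) (R - r)) * kap s r R m x := by
  induction k generalizing x with
  | zero => simp [Phi, ck]
  | succ k ih =>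
    unfold Phi
    have hm : Measurable fun z : Fin (k+1) → E3 => chain s (k+1) x z x' * ck r R (k+1) z :=
      (Measurable.chain' measurable_const measurable_const measurable_id
        measurable_const).mul (measurable_ck r R _)
    rw [lintegral_cons hm]
    simp only [chain, ck, Fin.cons_zero, Fin.tail_cons]
    have hmc : ∀ z0 : E3, Measurable fun z : Fin k → E3 => chain s k z0 z x' := fun z0 =>
      Measurable.chain' measurable_const measurable_const measurable_id measurable_const
    have h1 : ∀ z0 : E3, ∫⁻ z, pE s x z0 * chain s k z0 z x' *
          (iI r z0 + iD r R z0 * ck r R k z) ∂(vk k)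
        ≤ ENNReal.ofReal (pd (((k + 1 : ℕ) : ℝ) * s) (R - r)) * (pE s x z0 * iI r z0)
          + ∑ m ∈ Finset.range k, ENNReal.ofReal (pd (((k - m : ℕ) : ℝ) * s) (R - r)) *
            (pE s x z0 * (iD r R z0 * kap s r R m z0)) := by
      intro z0
      have e : ∀ z, pE s x z0 * chain s k z0 z x' * (iI r z0 + iD r R z0 * ck r R k z)
          = pE s x z0 * (iI r z0 * chain s k z0 z x'
            + iD r R z0 * (chain s k z0 z x' * ck r R k z)) := by intro z; ring
      simp_rw [e]
      have hIt : iI r z0 ≠ ∞ := by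
        unfold iI; by_cases h : z0 ∈ sI r <;> simp [h]
      have hDt : iD r R z0 ≠ ∞ := by
        unfold iD; by_cases h : z0 ∈ sD r R <;> simp [h]
      rw [lintegral_const_mul' _ _ (by simp [pE]), lintegral_add_left ((hmc z0).const_mul _),
        lintegral_const_mul' _ _ hIt, lintegral_const_mul' _ _ hDt, chain_total hs, mul_add]
      apply add_le_add
      · by_cases h : z0 ∈ sI r
        · have := pE_le_pd (s := ((k:ℝ) + 1) * s) (by positivity) hR h hx
          simp only [iI, Set.indicator_of_mem h, Pi.one_apply, one_mul, mul_one]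
          rw [mul_comm]
          push_cast
          exact mul_le_mul_left this _
        · simp [iI, h]
      · have := ih z0
        unfold Phi at this
        calc _ ≤ pE s x z0 * (iD r R z0 * ∑ m ∈ Finset.range k,
              ENNReal.ofReal (pd (((k - m : ℕ) : ℝ) * s) (R - r)) * kap s r R m z0) := by
              gcongr
          _ = _ := by
              rw [Finset.mul_sum, Finset.mul_sum]
              refine Finset.sum_congr rfl fun m _ => ?_
              ring
    refine (lintegral_mono h1).trans (le_of_eq ?_)
    rw [lintegral_add_left ((meas_pI s r x).const_mul _), lintegral_const_mul' _ _ (by simp),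
      lintegral_finsetSum _ (fun m _ => (meas_pD s r R x (measurable_kap s r R m)).const_mul _),
      Finset.sum_range_succ', add_comm]
    simp only [lintegral_const_mul' _ _ ENNReal.ofReal_ne_top]
    congr 1
    refine Finset.sum_congr rfl fun m _ => ?_
    rw [Nat.add_sub_add_right]
    rfl

lemma sum_conv_le (a b : ℕ → ℝ≥0∞) (N : ℕ) :
    ∑ k ∈ Finset.range N, ∑ m ∈ Finset.range k, a (k - m) * b m
      ≤ (∑ i ∈ Finset.range N, a (i + 1)) * ∑' m, b m := by
  rw [Finset.sum_comm' (t' := Finset.range N) (s' := fun m => Finset.Ico (m + 1) N)]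
  · calc _ ≤ ∑ m ∈ Finset.range N, (∑ i ∈ Finset.range N, a (i + 1)) * b m := by
          refine Finset.sum_le_sum fun m _ => ?_
          rw [Finset.sum_Ico_eq_sum_range, Finset.sum_mul]
          have : ∀ i, m + 1 + i - m = i + 1 := by intro i; omega
          simp_rw [this]
          apply Finset.sum_le_sum_of_subset
          intro i; simp only [Finset.mem_range]; omega
      _ ≤ _ := by
          rw [← Finset.mul_sum]
          gcongr
          exact ENNReal.sum_le_tsum _
  · intro k m
    simp only [Finset.mem_range, Finset.mem_Ico]
    omega

noncomputable def Theta (s r R : ℝ) (k : ℕ) : ℝ≥0∞ := ∫⁻ x, iO R x * Phi s r R k x x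

lemma measurable_Phi_diag (r R : ℝ) (k : ℕ) :
    Measurable (fun q : ℝ × E3 => Phi q.1 r R k q.2 q.2) := by
  unfold Phi
  apply Measurable.lintegral_prod_right' (f := fun q : (ℝ × E3) × (Fin k → E3) =>
    chain q.1.1 k q.1.2 q.2 q.1.2 * ck r R k q.2)
  exact (Measurable.chain' (by fun_prop) (by fun_prop) (by fun_prop) (by fun_prop)).mul
    ((measurable_ck r R k).comp measurable_snd)

lemma measurable_Theta (r R : ℝ) (k : ℕ) : Measurable (fun s => Theta s r R k) := by
  unfold Theta
  apply Measurable.lintegral_prod_right' (f := fun q : ℝ × E3 => iO R q.2 * Phi q.1 r R k q.2 q.2)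
  exact ((measurable_iO R).comp measurable_snd).mul (measurable_Phi_diag r R k)

lemma sum_Theta_le {s r R : ℝ} (hs : 0 < s) (hr : 0 < r) (hR : r < R) (N : ℕ) :
    ∑ k ∈ Finset.range N, Theta s r R k ≤
      (∑ i ∈ Finset.range N, ENNReal.ofReal (pd (((i + 1 : ℕ) : ℝ) * s) (R - r))) *
        ENNReal.ofReal (s * (2 * π / (r⁻¹ - R⁻¹))) := by
  unfold Theta
  have hm : ∀ k, Measurable fun x => iO R x * Phi s r R k x x := fun k =>
    (measurable_iO R).mul ((measurable_Phi_diag r R k).comp (measurable_const.prodMk measurable_id))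
  rw [← lintegral_finsetSum _ (fun k _ => hm k)]
  calc _ ≤ ∫⁻ x, (∑ i ∈ Finset.range N, ENNReal.ofReal (pd (((i + 1 : ℕ) : ℝ) * s) (R - r))) *
          (sO R).indicator (Uf s r R) x := by
        apply lintegral_mono
        intro x
        by_cases hx : x ∈ sO R
        · simp only [iO, Set.indicator_of_mem hx, Pi.one_apply, one_mul]
          refine le_trans (Finset.sum_le_sum fun k _ => Phi_le hs hR k x x hx) ?_
          exact sum_conv_le (fun j => ENNReal.ofReal (pd ((j : ℝ) * s) (R - r)))
            (fun m => kap s r R m x) N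
        · simp [iO, hx]
    _ = (∑ i ∈ Finset.range N, ENNReal.ofReal (pd (((i + 1 : ℕ) : ℝ) * s) (R - r))) *
          ∫⁻ x in sO R, Uf s r R x := by
        rw [lintegral_const_mul _ ((measurable_Uf s r R).indicator (msO R)),
          lintegral_indicator (msO R)]
    _ ≤ _ := by
        gcongr
        exact lintegral_Uf_le hs hr hR

/-- the harmonic sum -/
noncomputable def HN (N : ℕ) : ℝ≥0∞ := ∑ i ∈ Finset.range N, ENNReal.ofReal (1 / ((i:ℝ) + 1))

lemma lintegral_sum_Theta {r R : ℝ} (hr : 0 < r) (hR : r < R) (N : ℕ) :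
    ∫⁻ s in Set.Ioi (0:ℝ), ENNReal.ofReal s⁻¹ * ∑ k ∈ Finset.range N, Theta s r R k
      ≤ HN N * ENNReal.ofReal (1 / (r⁻¹ - R⁻¹) / (R - r)) := by
  have h := (inv_lt_inv₀ (hr.trans hR) hr).2 hR
  have h' : 0 < r⁻¹ - R⁻¹ := by linarith
  have hRr : 0 < R - r := by linarith
  have hpm : ∀ c : ℝ, Measurable fun s : ℝ => ENNReal.ofReal (pd (c * s) (R - r)) := fun c =>
    (measurable_pd.comp (Measurable.prodMk (by fun_prop) measurable_const)).ennreal_ofReal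
  calc _ ≤ ∫⁻ s in Set.Ioi (0:ℝ), (∑ i ∈ Finset.range N,
          ENNReal.ofReal (pd (((i + 1 : ℕ) : ℝ) * s) (R - r))) *
            ENNReal.ofReal (2 * π / (r⁻¹ - R⁻¹)) := by
        apply setLIntegral_mono' measurableSet_Ioi
        intro s hs
        have hs : 0 < s := hs
        calc _ ≤ ENNReal.ofReal s⁻¹ * ((∑ i ∈ Finset.range N,
              ENNReal.ofReal (pd (((i + 1 : ℕ) : ℝ) * s) (R - r))) *
              ENNReal.ofReal (s * (2 * π / (r⁻¹ - R⁻¹)))) := by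
              gcongr
              exact sum_Theta_le hs hr hR N
          _ = _ := by
              rw [mul_left_comm, ← ENNReal.ofReal_mul (by positivity)]
              congr 2
              field_simp
    _ = (∑ i ∈ Finset.range N, ∫⁻ s in Set.Ioi (0:ℝ),
          ENNReal.ofReal (pd (((i + 1 : ℕ) : ℝ) * s) (R - r))) *
            ENNReal.ofReal (2 * π / (r⁻¹ - R⁻¹)) := by
        rw [lintegral_mul_const' _ _ (by simp), lintegral_finsetSum _ (fun i _ => hpm _)]
    _ = (HN N * ENNReal.ofReal (1 / (2 * π * (R - r)))) *
            ENNReal.ofReal (2 * π / (r⁻¹ - R⁻¹)) := by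
        unfold HN
        refine congrArg (· * ENNReal.ofReal (2 * π / (r⁻¹ - R⁻¹))) ?_
        rw [Finset.sum_mul]
        refine Finset.sum_congr rfl fun i _ => ?_
        have h2 := lintegral_comp_mul_Ioi (fun t => ENNReal.ofReal (pd t (R - r)))
          (c := ((i + 1 : ℕ) : ℝ)) (by positivity)
        rw [lintegral_pd_time hRr] at h2
        rw [← h2, ← mul_assoc, ← ENNReal.ofReal_mul (by positivity)]
        have : 1 / ((i:ℝ) + 1) * ((i + 1 : ℕ) : ℝ) = 1 := by push_cast; field_simp
        rw [this]; simp
    _ = _ := by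
        rw [mul_assoc, ← ENNReal.ofReal_mul (by positivity)]
        congr 2
        field_simp

end LoopCross

open MeasureTheory Real
open scoped ENNReal

namespace LoopCross

/-- configurations visiting both the inner ball and the outer region -/
def cross (r R : ℝ) (k : ℕ) : Set (Fin (k+1) → E3) :=
  {y | (∃ i, y i ∈ sI r) ∧ ∃ i, y i ∈ sO R}

lemma ms_cross (r R : ℝ) (k : ℕ) : MeasurableSet (cross r R k) := by
  have : cross r R k = (⋃ i, (fun y : Fin (k+1) → E3 => y i) ⁻¹' sI r) ∩
      ⋃ i, (fun y : Fin (k+1) → E3 => y i) ⁻¹' sO R := by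
    ext y; simp [cross]
  rw [this]
  exact (MeasurableSet.iUnion fun i => measurable_pi_apply i (msI r)).inter
    (MeasurableSet.iUnion fun i => measurable_pi_apply i (msO R))

noncomputable def iA (r R : ℝ) (k : ℕ) : (Fin (k+1) → E3) → ℝ≥0∞ := (cross r R k).indicator 1

lemma measurable_iA (r R : ℝ) (k : ℕ) : Measurable (iA r R k) :=
  measurable_one.indicator (ms_cross r R k)

lemma ck_ge (r R : ℝ) (k : ℕ) (z : Fin k → E3) (m : ℕ) (hm : m < k) (h1 : z ⟨m, hm⟩ ∈ sI r)
    (h2 : ∀ l (hl : l < m), z ⟨l, hl.trans hm⟩ ∈ sD r R) : 1 ≤ ck r R k z := by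
  induction k generalizing m with
  | zero => omega
  | succ k ih =>
    simp only [ck]
    cases m with
    | zero =>
      have : z 0 ∈ sI r := h1
      simp [iI, this]
    | succ m =>
      have h0 : z 0 ∈ sD r R := h2 0 (by omega)
      have := ih (Fin.tail z) m (by omega) h1 (fun l hl => h2 (l+1) (by omega))
      simp only [iD, Set.indicator_of_mem h0, Pi.one_apply, one_mul]
      exact this.trans le_add_self

lemma cross_shift {r R : ℝ} (hR : r < R) (k : ℕ) (y : Fin (k+1) → E3) (hy : y ∈ cross r R k) :
    ∃ i, y i ∈ sO R ∧ 1 ≤ ck r R k (Fin.tail fun j : Fin (k+1) => y (j + i)) := by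
  classical
  obtain ⟨⟨a, ha⟩, b, hb⟩ := hy
  let P : ℕ → Prop := fun m => ∃ i, y i ∈ sO R ∧ y (Fin.ofNat (k+1) m + i) ∈ sI r
  have hP0 : P (a - b).val := by
    refine ⟨b, hb, ?_⟩
    have : Fin.ofNat (k+1) (a - b).val + b = a := by
      rw [Fin.ofNat_val_eq_self, sub_add_cancel]
    rwa [this]
  have hP : ∃ m, P m := ⟨_, hP0⟩
  set m := Nat.find hP with hmdef
  have hmk : m ≤ k := (Nat.find_min' hP hP0).trans (by omega)
  obtain ⟨i, hiO, hiI⟩ := Nat.find_spec hP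
  rw [← hmdef] at hiI
  have hlt : ∀ l, l < m → ¬ P l := fun l hl => Nat.find_min hP hl
  have hm0 : m ≠ 0 := by
    intro h0
    rw [h0] at hiI
    have : Fin.ofNat (k+1) 0 + i = i := by
      have : Fin.ofNat (k+1) 0 = 0 := rfl
      rw [this, zero_add]
    rw [this] at hiI
    have h1 : ‖y i‖ < r := hiI
    have h2 : R < ‖y i‖ := hiO
    linarith
  refine ⟨i, hiO, ?_⟩
  have hof : ∀ l (hl : l < k), Fin.tail (fun j : Fin (k+1) => y (j + i)) ⟨l, hl⟩
      = y (Fin.ofNat (k+1) (l+1) + i) := by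
    intro l hl
    have : (⟨l, hl⟩ : Fin k).succ = Fin.ofNat (k+1) (l+1) := by
      ext; simp [Nat.mod_eq_of_lt (show l + 1 < k + 1 by omega)]
    simp only [Fin.tail, this]
  refine ck_ge r R k _ (m - 1) (by omega) ?_ ?_
  · rw [hof, Nat.sub_add_cancel (by omega)]; exact hiI
  · intro l hl
    rw [hof]
    have hnI : ¬ y (Fin.ofNat (k+1) (l+1) + i) ∈ sI r := fun h => hlt (l+1) (by omega) ⟨i, hiO, h⟩
    have hnO : ¬ y (Fin.ofNat (k+1) (l+1) + i) ∈ sO R := by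
      intro h
      refine hlt (m - (l+1)) (by omega) ⟨_, h, ?_⟩
      have : Fin.ofNat (k+1) (m - (l+1)) + (Fin.ofNat (k+1) (l+1) + i) = Fin.ofNat (k+1) m + i := by
        rw [← add_assoc]
        congr 1
        ext
        simp only [Fin.val_add, Fin.val_ofNat]
        rw [← Nat.add_mod]
        congr 1; omega
      rw [this]; exact hiI
    exact ⟨not_lt.1 hnI, not_lt.1 hnO⟩

/-- cyclic product of heat kernels -/
noncomputable def cyc (s : ℝ) (k : ℕ) (y : Fin (k+1) → E3) : ℝ≥0∞ :=
  ∏ j : Fin (k+1), pE s (y j) (y (j+1))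

lemma cyc_shift (s : ℝ) (k : ℕ) (y : Fin (k+1) → E3) (i : Fin (k+1)) :
    cyc s k (fun j => y (j + i)) = cyc s k y := by
  unfold cyc
  rw [← Equiv.prod_comp (Equiv.addRight i) (fun j => pE s (y j) (y (j+1)))]
  refine Finset.prod_congr rfl fun j _ => ?_
  simp only [Equiv.coe_addRight, add_right_comm]

lemma measurable_cyc (s : ℝ) (k : ℕ) : Measurable (cyc s k) := by
  unfold cyc
  exact Finset.measurable_prod _ fun j _ => Measurable.pE' measurable_const
    (measurable_pi_apply j) (measurable_pi_apply (j+1))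

lemma lintegral_shift {k : ℕ} (i : Fin (k+1)) {f : (Fin (k+1) → E3) → ℝ≥0∞} (hf : Measurable f) :
    ∫⁻ y, f (fun j => y (j + i)) ∂(vk (k+1)) = ∫⁻ y, f y ∂(vk (k+1)) := by
  have h := measurePreserving_piCongrLeft (fun _ : Fin (k+1) => (volume : Measure E3))
    (Equiv.addRight (-i))
  rw [← h.lintegral_comp hf]
  refine lintegral_congr fun y => ?_
  congr 1
  funext j
  have := MeasurableEquiv.piCongrLeft_apply_apply (β := fun _ : Fin (k+1) => E3)
    (Equiv.addRight (-i)) y (j + i)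
  simpa using this.symm

lemma chain_eq_prod (s : ℝ) (k : ℕ) (x : E3) (z : Fin k → E3) (x' : E3) :
    chain s k x z x' = ∏ j : Fin (k+1), pE s
      ((Fin.snoc (Fin.cons x z) x' : Fin (k+2) → E3) j.castSucc)
      ((Fin.snoc (Fin.cons x z) x' : Fin (k+2) → E3) j.succ) := by
  induction k generalizing x with
  | zero =>
    simp only [chain, Fin.prod_univ_succ, Fin.snoc_castSucc]
    simp [Fin.snoc]
  | succ k ih =>
    rw [Fin.prod_univ_succ]
    simp only [chain]
    rw [ih]
    have e : (Fin.snoc (Fin.cons x z) x' : Fin (k+3) → E3) =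
        Fin.cons x (Fin.snoc (Fin.cons (z 0) (Fin.tail z)) x' : Fin (k+2) → E3) := by
      rw [Fin.cons_snoc_eq_snoc_cons]
      congr 2
      exact (Fin.cons_self_tail z).symm
    rw [e]
    congr 1

lemma cyc_cons (s : ℝ) (k : ℕ) (x : E3) (z : Fin k → E3) :
    cyc s k (Fin.cons x z) = chain s k x z x := by
  rw [chain_eq_prod]
  unfold cyc
  refine Finset.prod_congr rfl fun j _ => ?_
  rw [Fin.snoc_castSucc]
  congr 1
  refine Fin.lastCases ?_ (fun i => ?_) j
  · rw [Fin.last_add_one, Fin.cons_zero, Fin.succ_last, Fin.snoc_last]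
  · rw [Fin.coeSucc_eq_succ, Fin.succ_castSucc, Fin.snoc_castSucc]

/-- mass of crossing discrete loops -/
noncomputable def Tn (s r R : ℝ) (k : ℕ) : ℝ≥0∞ :=
  ∫⁻ x, ∫⁻ z, chain s k x z x * iA r R k (Fin.cons x z) ∂(vk k)

lemma Tn_le {r R : ℝ} (hR : r < R) (s : ℝ) (k : ℕ) :
    Tn s r R k ≤ ((k + 1 : ℕ) : ℝ≥0∞) * Theta s r R k := by
  have hmA : Measurable fun y : Fin (k+1) → E3 => cyc s k y * iA r R k y :=
    (measurable_cyc s k).mul (measurable_iA r R k)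
  let F : (Fin (k+1) → E3) → ℝ≥0∞ := fun y => cyc s k y * (iO R (y 0) * ck r R k (Fin.tail y))
  have hF : Measurable F := (measurable_cyc s k).mul
    (((measurable_iO R).comp (measurable_pi_apply 0)).mul
      ((measurable_ck r R k).comp measurable_tail))
  have hFs : ∀ i : Fin (k+1), Measurable fun y : Fin (k+1) → E3 => F (fun j => y (j + i)) :=
    fun i => hF.comp (by fun_prop)
  have hpt : ∀ y, cyc s k y * iA r R k y ≤ ∑ i : Fin (k+1), F (fun j => y (j + i)) := by
    intro y
    by_cases hy : y ∈ cross r R k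
    · obtain ⟨i, hi, hc⟩ := cross_shift hR k y hy
      refine le_trans ?_ (Finset.single_le_sum (f := fun i => F (fun j => y (j + i)))
        (fun _ _ => bot_le) (Finset.mem_univ i))
      simp only [F, cyc_shift, zero_add, iA, Set.indicator_of_mem hy, iO, Set.indicator_of_mem hi,
        Pi.one_apply, one_mul]
      exact mul_le_mul_right hc _
    · simp [iA, hy]
  calc Tn s r R k = ∫⁻ y, cyc s k y * iA r R k y ∂(vk (k+1)) := by
        rw [lintegral_cons hmA]
        unfold Tn
        simp_rw [cyc_cons]
    _ ≤ ∫⁻ y, ∑ i : Fin (k+1), F (fun j => y (j + i)) ∂(vk (k+1)) := lintegral_mono hpt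
    _ = ∑ i : Fin (k+1), ∫⁻ y, F y ∂(vk (k+1)) := by
        rw [lintegral_finsetSum _ (fun i _ => hFs i)]
        exact Finset.sum_congr rfl fun i _ => lintegral_shift i hF
    _ = ((k + 1 : ℕ) : ℝ≥0∞) * ∫⁻ y, F y ∂(vk (k+1)) := by simp
    _ = _ := by
        congr 1
        rw [lintegral_cons hF]
        unfold Theta Phi
        refine lintegral_congr fun x => ?_
        simp only [F, cyc_cons, Fin.cons_zero, Fin.tail_cons]
        rw [← lintegral_const_mul' _ _ (by unfold iO; by_cases h : x ∈ sO R <;> simp [h])]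
        refine lintegral_congr fun z => ?_
        ring

lemma measurable_Jn (r R : ℝ) (k : ℕ) : Measurable (fun q : ℝ × E3 =>
    ∫⁻ z, chain q.1 k q.2 z q.2 * iA r R k (Fin.cons q.2 z) ∂(vk k)) := by
  apply Measurable.lintegral_prod_right' (f := fun q : (ℝ × E3) × (Fin k → E3) =>
    chain q.1.1 k q.1.2 q.2 q.1.2 * iA r R k (Fin.cons q.1.2 q.2))
  refine (Measurable.chain' (by fun_prop) (by fun_prop) (by fun_prop) (by fun_prop)).mul
    ((measurable_iA r R k).comp (measurable_cons.comp (g := fun q : E3 × (Fin k → E3) =>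
      (Fin.cons q.1 q.2 : Fin (k+1) → E3)) (f := fun q : (ℝ × E3) × (Fin k → E3) =>
        (q.1.2, q.2)) ?_))
  fun_prop

/-- density of the discretised crossing loops -/
noncomputable def Wn (r R : ℝ) (k : ℕ) (x : E3) (t : ℝ) : ℝ≥0∞ :=
  ENNReal.ofReal t⁻¹ * ∫⁻ z, chain (t / ((k:ℝ)+1)) k x z x * iA r R k (Fin.cons x z) ∂(vk k)

lemma measurable_Wn (r R : ℝ) (k : ℕ) : Measurable (fun q : E3 × ℝ => Wn r R k q.1 q.2) := by
  unfold Wn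
  refine Measurable.mul (by fun_prop) ?_
  have : Measurable fun q : E3 × ℝ => (q.2 / ((k:ℝ)+1), q.1) := by fun_prop
  exact (measurable_Jn r R k).comp this

lemma lintegral_Wn_le {r R : ℝ} (hR : r < R) (k : ℕ) :
    ∫⁻ q, Wn r R k q.1 q.2 ∂((volume : Measure E3).prod (volume.restrict (Set.Ioi (0:ℝ))))
      ≤ ((k + 1 : ℕ) : ℝ≥0∞) * ∫⁻ s in Set.Ioi (0:ℝ), ENNReal.ofReal s⁻¹ * Theta s r R k := by
  rw [lintegral_prod_symm' _ (measurable_Wn r R k)]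
  have hJx : ∀ s, Measurable fun x : E3 =>
      ∫⁻ z, chain s k x z x * iA r R k (Fin.cons x z) ∂(vk k) := fun s =>
    (measurable_Jn r R k).comp (measurable_const.prodMk measurable_id)
  have h1 : ∀ t : ℝ, ∫⁻ x, Wn r R k x t = ENNReal.ofReal t⁻¹ * Tn (t / ((k:ℝ)+1)) r R k := by
    intro t
    unfold Wn Tn
    rw [lintegral_const_mul _ (hJx _)]
  simp only [h1]
  have hk : (0:ℝ) < ((k:ℝ)+1)⁻¹ := by positivity
  have h2 := lintegral_comp_mul_Ioi (fun s => ENNReal.ofReal s⁻¹ * Tn s r R k) hk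
  have h3 : ∫⁻ t in Set.Ioi (0:ℝ), ENNReal.ofReal t⁻¹ * Tn (t / ((k:ℝ)+1)) r R k
      = ∫⁻ s in Set.Ioi (0:ℝ), ENNReal.ofReal s⁻¹ * Tn s r R k := by
    rw [← h2, ← lintegral_const_mul' _ _ (by simp)]
    refine setLIntegral_congr_fun measurableSet_Ioi fun t ht => ?_
    have ht : (0:ℝ) < t := ht
    rw [← mul_assoc, ← ENNReal.ofReal_mul (by positivity)]
    congr 2
    · field_simp
    · field_simp
  rw [h3, ← lintegral_const_mul' _ _ (by simp)]
  apply lintegral_mono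
  intro s
  dsimp only
  rw [mul_left_comm]
  exact mul_le_mul_right (Tn_le hR s k) _

end LoopCross

open MeasureTheory Real
open scoped ENNReal

namespace LoopCross

abbrev PS := C(ℝ, E3)

/-- paths that visit both regions at the grid points -/
def gridA (r R : ℝ) (k : ℕ) (t : ℝ) : Set PS :=
  {w | (fun j : Fin (k+1) => w ((j:ℝ) * (t / ((k:ℝ)+1)))) ∈ cross r R k}

lemma bridge_grid {x : E3} {T : ℝ} (hT : 0 < T) {Q : Measure PS} (hQ : IsBrownianBridge 3 x T Q)
    (r R : ℝ) (k : ℕ) :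
    ENNReal.ofReal (T⁻¹ * (2 * π * T) ^ (-(3:ℝ)/2)) * Q (gridA r R k T) = Wn r R k x T := by
  obtain ⟨hp, hae, hfd⟩ := hQ
  have hk : (0:ℝ) < (k:ℝ) + 1 := by positivity
  set h : ℝ := T / ((k:ℝ)+1) with hh
  have hh0 : 0 < h := by positivity
  have hTh : T = ((k:ℝ)+1) * h := by rw [hh]; field_simp
  let t : Fin k → ℝ := fun j => ((j:ℝ) + 1) * h
  have ht : StrictMono t := by
    intro i j hij
    have : (i:ℝ) < (j:ℝ) := by exact_mod_cast hij
    simp only [t]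
    nlinarith
  have htm : ∀ j, t j ∈ Set.Ioo 0 T := by
    intro j
    have : (j:ℝ) < (k:ℝ) := by exact_mod_cast j.2
    simp only [t]
    constructor
    · positivity
    · nlinarith
  have hmap := hfd k t ht htm
  let S : Set (Fin k → E3) := {z | (Fin.cons x z : Fin (k+1) → E3) ∈ cross r R k}
  have hS : MeasurableSet S :=
    (measurable_cons.comp (g := fun q : E3 × (Fin k → E3) => (Fin.cons q.1 q.2 : Fin (k+1) → E3))
      (measurable_const.prodMk measurable_id : Measurable fun z : Fin k → E3 => (x, z)))
      (ms_cross r R k)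
  have hev : Measurable fun w : PS => fun j => w (t j) := by
    rw [measurable_pi_iff]
    intro j
    have : BorelSpace PS := ⟨rfl⟩
    exact (continuous_eval_const (t j)).measurable
  have hQS : Q (gridA r R k T) = Q.map (fun w => fun j => w (t j)) S := by
    rw [Measure.map_apply hev hS]
    apply measure_congr
    filter_upwards [hae] with w hw
    have : (fun j : Fin (k+1) => w ((j:ℝ) * (T / ((k:ℝ)+1)))) = Fin.cons x (fun j => w (t j)) := by
      funext j
      refine Fin.cases ?_ (fun i => ?_) j
      · simp [hw.1]
      · simp [t, hh]
    refine propext ?_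
    change (fun j : Fin (k+1) => w ((j:ℝ) * (T / ((k:ℝ)+1)))) ∈ cross r R k ↔ _
    rw [this]
    rfl
  have htt : ∀ j : Fin (k+2), (Fin.snoc (Fin.cons 0 t) T : Fin (k+2) → ℝ) j = (j:ℝ) * h := by
    intro j
    refine Fin.lastCases ?_ (fun i => ?_) j
    · rw [Fin.snoc_last]; simp [hTh]
    · rw [Fin.snoc_castSucc]
      refine Fin.cases ?_ (fun l => ?_) i
      · simp
      · simp [t]
  have hdens : ∀ z : Fin k → E3, (ENNReal.ofReal ((2 * π * T) ^ (((3:ℕ):ℝ)/2) *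
      ∏ j : Fin (k+1), heatKernel 3 ((Fin.snoc (Fin.cons 0 t) T : Fin (k+2) → ℝ) j.succ
        - (Fin.snoc (Fin.cons 0 t) T : Fin (k+2) → ℝ) j.castSucc)
        ((Fin.snoc (Fin.cons x z) x : Fin (k+2) → E3) j.castSucc)
        ((Fin.snoc (Fin.cons x z) x : Fin (k+2) → E3) j.succ)))
      = ENNReal.ofReal ((2 * π * T) ^ ((3:ℝ)/2)) * chain h k x z x := by
    intro z
    rw [ENNReal.ofReal_mul (by positivity), chain_eq_prod, ENNReal.ofReal_prod_of_nonneg]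
    · congr 1
      refine Finset.prod_congr rfl fun j _ => ?_
      unfold pE
      rw [htt, htt]
      congr 2
      simp; ring
    · intro j _
      rw [heatKernel_eq_pd]
      apply pd_nonneg
      rw [htt, htt]
      have : ((j.succ : Fin (k+2)) : ℝ) * h - ((j.castSucc : Fin (k+2)):ℝ) * h = h := by simp; ring
      rw [this]; exact hh0.le
  have hmc : Measurable fun z : Fin k → E3 => chain h k x z x :=
    Measurable.chain' measurable_const measurable_const measurable_id measurable_const
  rw [hQS, hmap]
  dsimp only
  simp_rw [hdens]
  rw [withDensity_apply _ hS, lintegral_const_mul _ hmc, ← mul_assoc,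
    ← ENNReal.ofReal_mul (by positivity)]
  unfold Wn
  have e1 : T⁻¹ * (2 * π * T) ^ (-(3:ℝ)/2) * (2 * π * T) ^ ((3:ℝ)/2) = T⁻¹ := by
    rw [mul_assoc, ← Real.rpow_add (by positivity)]
    norm_num
  rw [e1]
  congr 1
  rw [← lintegral_indicator hS]
  refine lintegral_congr fun z => ?_
  by_cases hz : z ∈ S
  · have : (Fin.cons x z : Fin (k+1) → E3) ∈ cross r R k := hz
    rw [← hh]
    simp [iA, hz, this]
  · have : (Fin.cons x z : Fin (k+1) → E3) ∉ cross r R k := hz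
    simp [iA, hz, this]

/-- open crossing event -/
def crossP (r R : ℝ) : Set PS := {w | (∃ s, w s ∈ sI r) ∧ ∃ s, w s ∈ sO R}

lemma isOpen_crossP (r R : ℝ) : IsOpen (crossP r R) := by
  have : crossP r R = (⋃ s, (fun w : PS => w s) ⁻¹' sI r) ∩ ⋃ s, (fun w : PS => w s) ⁻¹' sO R := by
    ext w; simp [crossP]
  rw [this]
  refine (isOpen_iUnion fun s => ?_).inter (isOpen_iUnion fun s => ?_)
  · exact (isOpen_lt continuous_norm continuous_const).preimage
      (continuous_eval_const s)
  · exact (isOpen_lt continuous_const continuous_norm).preimage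
      (continuous_eval_const s)

lemma eventually_grid {T : ℝ} (hT : 0 < T) {x : E3} {w : PS} (h0 : w 0 = x)
    (hx : ∀ s : ℝ, s ∉ Set.Ioo 0 T → w s = x) {U : Set E3} (hU : IsOpen U) {s : ℝ} (hs : w s ∈ U) :
    ∃ K : ℕ, ∀ k ≥ K, ∃ j : Fin (k+1), w ((j:ℝ) * (T / ((k:ℝ)+1))) ∈ U := by
  by_cases hsT : s ∈ Set.Ioo 0 T
  · have hV : IsOpen (w ⁻¹' U) := hU.preimage w.continuous
    obtain ⟨δ, hδ, hball⟩ := Metric.isOpen_iff.1 hV s hs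
    obtain ⟨K, hK⟩ := exists_nat_gt (T / δ)
    refine ⟨K, fun k hk => ?_⟩
    have hkK : (K:ℝ) ≤ k := by exact_mod_cast hk
    have hk1 : (0:ℝ) < (k:ℝ) + 1 := by positivity
    set h : ℝ := T / ((k:ℝ)+1) with hh
    have hh0 : 0 < h := by positivity
    have hTh : T = ((k:ℝ)+1) * h := by rw [hh]; field_simp
    have hhδ : h < δ := by
      rw [hh, div_lt_iff₀ hk1]
      rw [div_lt_iff₀ hδ] at hK
      nlinarith
    have hn0 : 0 ≤ s / h := div_nonneg hsT.1.le hh0.le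
    have hlow := Nat.floor_le hn0
    have hup := Nat.lt_floor_add_one (s / h)
    rw [le_div_iff₀ hh0] at hlow
    rw [div_lt_iff₀ hh0] at hup
    have hlt : ⌊s / h⌋₊ < k + 1 := by
      rw [Nat.floor_lt hn0, div_lt_iff₀ hh0]
      push_cast
      rw [← hTh]; exact hsT.2
    refine ⟨⟨_, hlt⟩, hball ?_⟩
    rw [Metric.mem_ball, Real.dist_eq, abs_lt]
    dsimp only
    constructor <;> nlinarith
  · refine ⟨0, fun k _ => ⟨0, ?_⟩⟩
    have : w ((((0 : Fin (k+1)) : ℕ) : ℝ) * (T / ((k:ℝ)+1))) = w s := by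
      rw [hx s hsT, ← h0]; simp
    rw [this]; exact hs

lemma bridge_cross_le {x : E3} {T : ℝ} (hT : 0 < T) {Q : Measure PS}
    (hQ : IsBrownianBridge 3 x T Q) (r R : ℝ) :
    ENNReal.ofReal (T⁻¹ * (2 * π * T) ^ (-(3:ℝ)/2)) * Q (crossP r R)
      ≤ ⨆ K : ℕ, ⨅ k : ℕ, Wn r R (k + K) x T := by
  have h1 : Q (crossP r R) ≤ Q (⋃ K : ℕ, ⋂ k : ℕ, gridA r R (k + K) T) := by
    apply measure_mono_ae
    filter_upwards [hQ.2.1] with w hw hc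
    obtain ⟨⟨s1, hs1⟩, s2, hs2⟩ := hc
    obtain ⟨K1, hK1⟩ := eventually_grid hT hw.1 hw.2
      (isOpen_lt continuous_norm continuous_const : IsOpen (sI r)) hs1
    obtain ⟨K2, hK2⟩ := eventually_grid hT hw.1 hw.2
      (isOpen_lt continuous_const continuous_norm : IsOpen (sO R)) hs2
    refine Set.mem_iUnion.2 ⟨K1 + K2, Set.mem_iInter.2 fun k => ?_⟩
    exact ⟨hK1 _ (by omega), hK2 _ (by omega)⟩
  have hmono : Monotone fun K : ℕ => ⋂ k : ℕ, gridA r R (k + K) T := by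
    intro K L hKL w hw
    refine Set.mem_iInter.2 fun k => ?_
    have := Set.mem_iInter.1 hw (k + (L - K))
    have e : k + (L - K) + K = k + L := by omega
    rwa [e] at this
  rw [hmono.measure_iUnion] at h1
  refine (mul_le_mul_right h1 _).trans ?_
  rw [ENNReal.mul_iSup]
  refine iSup_mono fun K => le_iInf fun k => ?_
  rw [← bridge_grid hT hQ r R (k + K)]
  exact mul_le_mul_right (measure_mono (Set.iInter_subset _ k)) _

lemma HN_eq (N : ℕ) : HN N = ENNReal.ofReal (∑ i ∈ Finset.range N, 1 / ((i:ℝ) + 1)) := by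
  unfold HN
  rw [ENNReal.ofReal_sum_of_nonneg]
  intro i _; positivity

lemma log_avg (g : ℝ≥0∞) (θ : ℕ → ℝ≥0∞) {B : ℝ} (hB : 0 ≤ B) (K : ℕ)
    (h1 : ∀ k, K ≤ k → g ≤ ((k + 1 : ℕ) : ℝ≥0∞) * θ k)
    (h2 : ∀ N, ∑ k ∈ Finset.range N, θ k ≤ HN N * ENNReal.ofReal B) : g ≤ ENNReal.ofReal B := by
  have hle : ∀ k, K ≤ k → ENNReal.ofReal (1 / ((k:ℝ) + 1)) * g ≤ θ k := by
    intro k hk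
    refine (mul_le_mul_right (h1 k hk) _).trans (le_of_eq ?_)
    rw [← mul_assoc, ← ENNReal.ofReal_natCast, ← ENNReal.ofReal_mul (by positivity)]
    have : 1 / ((k:ℝ) + 1) * ((k + 1 : ℕ) : ℝ) = 1 := by push_cast; field_simp
    rw [this]; simp
  have hg : g ≠ ∞ := by
    rintro rfl
    have a := hle K le_rfl
    have b := (Finset.single_le_sum (f := θ) (fun _ _ => bot_le)
      (Finset.mem_range.2 (Nat.lt_succ_self K))).trans (h2 (K+1))
    have c := a.trans b
    rw [HN_eq, ← ENNReal.ofReal_mul (by positivity), ENNReal.mul_top, top_le_iff] at c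
    · exact ENNReal.ofReal_ne_top c
    · simp only [ne_eq, ENNReal.ofReal_eq_zero, not_le]; positivity
  lift g to NNReal using hg
  have key : ∀ N, (∑ i ∈ Finset.range N, 1 / ((i:ℝ) + 1)) * (g:ℝ)
      ≤ (∑ i ∈ Finset.range N, 1 / ((i:ℝ) + 1)) * B
        + (∑ i ∈ Finset.range K, 1 / ((i:ℝ) + 1)) * (g:ℝ) := by
    intro N
    have e : HN N * (g:ℝ≥0∞) ≤ HN N * ENNReal.ofReal B + HN K * (g:ℝ≥0∞) := by
      calc HN N * (g:ℝ≥0∞) ≤ ∑ i ∈ Finset.range N, (θ i +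
            if i < K then ENNReal.ofReal (1 / ((i:ℝ) + 1)) * (g:ℝ≥0∞) else 0) := by
            unfold HN
            rw [Finset.sum_mul]
            refine Finset.sum_le_sum fun i _ => ?_
            by_cases hi : i < K
            · simp [hi]
            · simpa [hi] using hle i (not_lt.1 hi)
        _ ≤ _ := by
            rw [Finset.sum_add_distrib]
            refine add_le_add (h2 N) ?_
            rw [← Finset.sum_filter, HN, Finset.sum_mul]
            apply Finset.sum_le_sum_of_subset
            intro i; simp
    rw [HN_eq, HN_eq] at e
    have n1 : 0 ≤ ∑ i ∈ Finset.range N, 1 / ((i:ℝ) + 1) := by positivity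
    have n2 : 0 ≤ ∑ i ∈ Finset.range K, 1 / ((i:ℝ) + 1) := by positivity
    have eg : (g:ℝ≥0∞) = ENNReal.ofReal (g:ℝ) := by simp
    rw [eg, ← ENNReal.ofReal_mul n1, ← ENNReal.ofReal_mul n1, ← ENNReal.ofReal_mul n2,
      ← ENNReal.ofReal_add (by positivity) (by positivity)] at e
    exact (ENNReal.ofReal_le_ofReal_iff (by positivity)).1 e
  have hfin : (g:ℝ) ≤ B := by
    by_contra hlt
    push Not at hlt
    have hd : 0 < (g:ℝ) - B := by linarith
    obtain ⟨N, hN⟩ := (Real.tendsto_sum_range_one_div_nat_succ_atTop.eventually_gt_atTop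
      ((∑ i ∈ Finset.range K, 1 / ((i:ℝ) + 1)) * (g:ℝ) / ((g:ℝ) - B))).exists
    rw [div_lt_iff₀ hd] at hN
    have := key N
    nlinarith
  have eg : (g:ℝ≥0∞) = ENNReal.ofReal (g:ℝ) := by simp
  rw [eg]
  exact ENNReal.ofReal_le_ofReal hfin

lemma loop_cross_le {μ : Measure PS} (hμ : IsBrownianLoopMeasure μ) {r R : ℝ} (hr : 0 < r)
    (hR : r < R) : μ (crossP r R) ≤ ENNReal.ofReal (1 / (r⁻¹ - R⁻¹) / (R - r)) := by
  obtain ⟨Q, hQ, hμA⟩ := hμ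
  have hbs : BorelSpace PS := ⟨rfl⟩
  have h := (inv_lt_inv₀ (hr.trans hR) hr).2 hR
  have hB : 0 ≤ 1 / (r⁻¹ - R⁻¹) / (R - r) :=
    div_nonneg (div_nonneg zero_le_one (by linarith)) (by linarith)
  rw [hμA _ (isOpen_crossP r R).measurableSet]
  let G : ℕ → E3 × ℝ → ℝ≥0∞ := fun K q => ⨅ k : ℕ, Wn r R (k + K) q.1 q.2
  have hG : ∀ K, Measurable (G K) := fun K => Measurable.iInf fun k => measurable_Wn r R (k + K)
  have hGm : Monotone G := by
    intro K L hKL q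
    refine le_iInf fun k => ?_
    have := iInf_le (fun k : ℕ => Wn r R (k + K) q.1 q.2) (k + (L - K))
    have e : k + (L - K) + K = k + L := by omega
    rwa [e] at this
  calc _ ≤ ∫⁻ x : E3, ∫⁻ t in Set.Ioi (0:ℝ), ⨆ K, G K (x, t) := by
        refine lintegral_mono fun x => ?_
        refine setLIntegral_mono' measurableSet_Ioi fun t ht => ?_
        exact bridge_cross_le ht (hQ x t ht) r R
    _ = ∫⁻ q, ⨆ K, G K q ∂((volume : Measure E3).prod (volume.restrict (Set.Ioi (0:ℝ)))) := by
        rw [lintegral_prod _ (Measurable.iSup hG).aemeasurable]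
    _ = ⨆ K, ∫⁻ q, G K q ∂((volume : Measure E3).prod (volume.restrict (Set.Ioi (0:ℝ)))) :=
        lintegral_iSup hG hGm
    _ ≤ _ := by
        refine iSup_le fun K => ?_
        refine log_avg _ (fun k => ∫⁻ s in Set.Ioi (0:ℝ), ENNReal.ofReal s⁻¹ * Theta s r R k)
          hB K ?_ ?_
        · intro k hk
          refine le_trans (lintegral_mono fun q => ?_) (lintegral_Wn_le hR k)
          have := iInf_le (fun k : ℕ => Wn r R (k + K) q.1 q.2) (k - K)
          rwa [Nat.sub_add_cancel hk] at this
        · intro N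
          refine le_trans (le_of_eq ?_) (lintegral_sum_Theta hr hR N)
          have hm : ∀ k, Measurable fun s : ℝ => ENNReal.ofReal s⁻¹ * Theta s r R k := fun k =>
            Measurable.mul (by fun_prop) (measurable_Theta r R k)
          rw [← lintegral_finsetSum _ (fun k _ => hm k)]
          simp_rw [Finset.mul_sum]

end LoopCross

/-- **Crossing a spherical shell.** For `r ∈ (0,1)`, the Brownian loop measure in `ℝ³` of the
set of loops intersecting both the unit sphere and the sphere of radius `r` is at most
`((1+r)/2)((1−r)^{−2} − 1)`. -/
theorem loop_measure_crossing_upper_bound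
    (μ : Measure C(ℝ, EuclideanSpace ℝ (Fin 3))) (hμ : IsBrownianLoopMeasure μ)
    (r : ℝ) (hr : r ∈ Set.Ioo (0:ℝ) 1) :
    μ {w | (∃ s : ℝ, ‖w s‖ = 1) ∧ (∃ s : ℝ, ‖w s‖ = r)}
      ≤ ENNReal.ofReal ((1 + r) / 2 * ((1 - r) ^ (-(2:ℝ)) - 1)) := by
  obtain ⟨hr0, hr1⟩ := hr
  let F : ℝ → ℝ := fun ε => 1 / ((r + ε)⁻¹ - (1 - ε)⁻¹) / ((1 - ε) - (r + ε))
  have hinv : 1 < r⁻¹ := (one_lt_inv₀ hr0).2 hr1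
  have hF : ContinuousAt F 0 := by
    have a1 : r + 0 ≠ 0 := by simpa using hr0.ne'
    have a2 : (1:ℝ) - 0 ≠ 0 := by norm_num
    have a3 : (r + 0)⁻¹ - (1 - 0)⁻¹ ≠ 0 := by
      simp only [add_zero, sub_zero, inv_one]; linarith
    have a4 : ((1:ℝ) - 0) - (r + 0) ≠ 0 := by
      simp only [add_zero, sub_zero]; linarith
    have c1 : ContinuousAt (fun ε : ℝ => r + ε) 0 := by fun_prop
    have c2 : ContinuousAt (fun ε : ℝ => 1 - ε) 0 := by fun_prop
    exact (continuousAt_const.div ((c1.inv₀ a1).sub (c2.inv₀ a2)) a3).div (c2.sub c1) a4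
  have hF0 : F 0 < (1 + r) / 2 * ((1 - r) ^ (-(2:ℝ)) - 1) := by
    have e1 : (1 - r) ^ (-(2:ℝ)) = ((1 - r) ^ 2)⁻¹ := by
      rw [Real.rpow_neg (by linarith)]; norm_cast
    have hd : 0 < 1 - r := by linarith
    have e2 : F 0 = r / (1 - r) ^ 2 := by
      simp only [F, add_zero, sub_zero, inv_one]
      have : r⁻¹ - 1 = (1 - r) / r := by field_simp
      rw [this]
      field_simp
    have e3 : (1 + r) / 2 * (((1 - r) ^ 2)⁻¹ - 1) = ((1 + r) / 2 * (1 - (1 - r) ^ 2)) / (1 - r) ^ 2 := by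
      field_simp
    rw [e1, e2, e3]
    apply div_lt_div_of_pos_right _ (by positivity)
    nlinarith [mul_pos hr0 hd, mul_pos (mul_pos hr0 hr0) hd]
  have hev := hF.eventually (gt_mem_nhds hF0)
  have hev2 : ∀ᶠ ε in nhdsWithin (0:ℝ) (Set.Ioi 0), F ε < (1 + r) / 2 * ((1 - r) ^ (-(2:ℝ)) - 1) :=
    hev.filter_mono nhdsWithin_le_nhds
  have hev3 : ∀ᶠ ε in nhdsWithin (0:ℝ) (Set.Ioi 0), ε ∈ Set.Ioo 0 ((1 - r) / 2) :=
    Ioo_mem_nhdsGT (by linarith)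
  obtain ⟨ε, hε, hε0, hε1⟩ := (hev2.and hev3).exists
  refine le_trans (measure_mono ?_) ((LoopCross.loop_cross_le hμ (r := r + ε) (R := 1 - ε)
    (by linarith) (by linarith)).trans (ENNReal.ofReal_le_ofReal hε.le))
  rintro w ⟨⟨s1, h1⟩, s2, h2⟩
  refine ⟨⟨s2, ?_⟩, s1, ?_⟩
  · change ‖w s2‖ < r + ε
    linarith
  · change 1 - ε < ‖w s1‖
    linarith
end
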